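/- arXiv:1407.0559 — 3 statements merged into one kernel-verified Lean document; each statement's English description precedes it below -/
import Mathlib

section
/- Let R be a commutative Noetherian semilocal ring, a an ideal of R, and M a finitely generated R-module. Then h_a^2(M) = inf{ i ≥ 0 : H^i_a(M) is not a skinny (weakly Laskerian) R-module }. -/
open CategoryTheory

noncomputable section

/-- An `R`-module `M` is *in dimension `< n`* if there exists a finitely generated
submodule `N ⊆ M` such that `dim Supp (M/N) < n`. -/
def InDimLT (R : Type) [CommRing R] (M : Type) [AddCommGroup M] [Module R M] (n : ℕ) : Prop :=
  ∃ N : Submodule R M, N.FG ∧ Order.krullDim (Module.support R (M ⧸ N)) < (n : WithBot ℕ∞)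

/-- The `i`-th local cohomology module of `M` with support in the ideal `a`. -/
def locCoh (R : Type) [CommRing R] (a : Ideal R) (i : ℕ)
    (M : Type) [AddCommGroup M] [Module R M] : ModuleCat R :=
  (localCohomology a i).obj (ModuleCat.of R M)

/-- The finiteness dimension `f_a(M)`:  the least `i` such that `H^i_a(M)` is not
finitely generated (`∞` if there is no such `i`). -/
def finDim (R : Type) [CommRing R] (a : Ideal R)
    (M : Type) [AddCommGroup M] [Module R M] : ℕ∞ :=
  sInf (Nat.cast '' {i : ℕ | ¬ Module.Finite R ↥(locCoh R a i M)})

/-- The `n`-th finiteness dimension `f_a^n(M)`. -/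
def finDimN (R : Type) [CommRing R] (a : Ideal R) (n : ℕ)
    (M : Type) [AddCommGroup M] [Module R M] : ℕ∞ :=
  sInf {d : ℕ∞ | ∃ p : PrimeSpectrum R,
    p ∈ Module.support R (M ⧸ (a • ⊤ : Submodule R M)) ∧
    (n : WithBot ℕ∞) ≤ ringKrullDim (R ⧸ p.asIdeal) ∧
    d = finDim (Localization.AtPrime p.asIdeal)
      (a.map (algebraMap R (Localization.AtPrime p.asIdeal)))
      (LocalizedModule p.asIdeal.primeCompl M)}

/-- `h_a^n(M)`: the least `i` such that `H^i_a(M)` is not in dimension `< n`. -/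
def hDimN (R : Type) [CommRing R] (a : Ideal R) (n : ℕ)
    (M : Type) [AddCommGroup M] [Module R M] : ℕ∞ :=
  sInf (Nat.cast '' {i : ℕ | ¬ InDimLT R ↥(locCoh R a i M) n})

/-- An `R`-module `M` is *skinny* (weakly Laskerian) if `Ass_R (M/N)` is finite for every
submodule `N` of `M`. -/
def IsSkinny (R : Type) [CommRing R] (M : Type) [AddCommGroup M] [Module R M] : Prop :=
  ∀ N : Submodule R M, (associatedPrimes R (M ⧸ N)).Finite

section Skinny

variable {R : Type} [CommRing R] {A B C : Type} [AddCommGroup A] [Module R A]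
  [AddCommGroup B] [Module R B] [AddCommGroup C] [Module R C]

lemma IsSkinny.of_injective (h : IsSkinny R B) (f : A →ₗ[R] B) (hf : Function.Injective f) :
    IsSkinny R A := by
  intro N
  refine (h (N.map f)).subset ?_
  refine associatedPrimes.subset_of_injective (f := N.mapQ (N.map f) f (Submodule.le_comap_map f N)) ?_
  rw [← LinearMap.ker_eq_bot, Submodule.ker_mapQ, Submodule.comap_map_eq_of_injective hf,
    Submodule.mkQ_map_self]

lemma IsSkinny.of_surjective (h : IsSkinny R A) (f : A →ₗ[R] B) (hf : Function.Surjective f) :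
    IsSkinny R B := by
  intro N
  refine (h (N.comap f)).subset ?_
  have e := LinearMap.quotKerEquivOfSurjective (N.mkQ ∘ₗ f) (N.mkQ_surjective.comp hf)
  have hk : LinearMap.ker (N.mkQ ∘ₗ f) = N.comap f := by
    rw [LinearMap.ker_comp, Submodule.ker_mkQ]
  rw [hk] at e
  exact (LinearEquiv.AssociatedPrimes.eq e).ge

lemma IsSkinny.of_exact (hA : IsSkinny R A) (hC : IsSkinny R C) (f : A →ₗ[R] B) (g : B →ₗ[R] C)
    (hfg : Function.Exact f g) : IsSkinny R B := by
  intro N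
  have h1 := hA (N.comap f)
  have h2 := hC (N.map g)
  refine (h1.union h2).subset ?_
  refine associatedPrimes.subset_union_of_exact
    (f := (N.comap f).mapQ N f le_rfl) (g := N.mapQ (N.map g) g (Submodule.le_comap_map g N)) ?_ ?_
  · rw [← LinearMap.ker_eq_bot, Submodule.ker_mapQ, Submodule.mkQ_map_self]
  · rw [LinearMap.exact_iff, Submodule.ker_mapQ, Submodule.range_mapQ, Submodule.comap_map_eq,
      Submodule.map_sup, Submodule.mkQ_map_self, bot_sup_eq, hfg.linearMap_ker_eq]

lemma IsSkinny.of_finite [IsNoetherianRing R] [Module.Finite R A] : IsSkinny R A :=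
  fun _ ↦ associatedPrimes.finite R _

lemma Module.mem_support_of_mem_associatedPrimes {p : Ideal R} (hp : p ∈ associatedPrimes R A) :
    (⟨p, hp.isPrime⟩ : PrimeSpectrum R) ∈ Module.support R A := by
  rw [Module.mem_support_iff_exists_annihilator]
  obtain ⟨x, hx⟩ := hp.eq_radical_colon
  refine ⟨x, fun r hr ↦ ?_⟩
  have : (⊥ : Submodule R A).colon {x} ≤ p := hx ▸ Ideal.le_radical
  refine this ?_
  rw [Submodule.mem_colon_singleton, Submodule.mem_bot]
  exact (Submodule.mem_annihilator_span_singleton _ _).mp hr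

lemma IsSkinny.of_support_finite (h : (Module.support R A).Finite) : IsSkinny R A := fun N ↦
  (h.image PrimeSpectrum.asIdeal).subset fun p hp ↦ ⟨⟨p, hp.isPrime⟩,
    Module.support_subset_of_surjective _ N.mkQ_surjective
      (Module.mem_support_of_mem_associatedPrimes hp), rfl⟩

/-- Every prime in the support contains an associated prime. -/
lemma Module.exists_associatedPrime_le_of_mem_support [IsNoetherianRing R] {p : PrimeSpectrum R}
    (hp : p ∈ Module.support R A) : ∃ q ∈ associatedPrimes R A, q ≤ p.asIdeal := by
  obtain ⟨x, hx⟩ := Module.mem_support_iff_exists_annihilator.mp hp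
  obtain ⟨q, hq, hqp⟩ := Ideal.exists_minimalPrimes_le hx
  refine ⟨q, ?_, hqp⟩
  exact associatedPrimes.subset_of_injective (R ∙ x).injective_subtype
    (Module.associatedPrimes.minimalPrimes_annihilator_subset_associatedPrimes R _ hq)

/-- `dim Supp A < 2` means that there is no chain of length two in the support. -/
lemma krullDim_support_lt_two_iff :
    Order.krullDim (Module.support R A) < ((2 : ℕ) : WithBot ℕ∞) ↔
      ∀ p ∈ Module.support R A, ∀ q r : PrimeSpectrum R, p < q → ¬ q < r := by
  rw [← not_le, Order.le_krullDim_iff, not_iff_comm]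
  push Not
  constructor
  · rintro ⟨p, hp, q, r, hpq, hqr⟩
    have hq := Module.mem_support_mono hpq.le hp
    have hr := Module.mem_support_mono hqr.le hq
    let a : Module.support R A := ⟨p, hp⟩
    let b : Module.support R A := ⟨q, hq⟩
    let c : Module.support R A := ⟨r, hr⟩
    have hab : a < b := hpq
    have hbc : b < c := hqr
    exact ⟨LTSeries.mk 2 ![a, b, c]
      (Fin.strictMono_iff_lt_succ.mpr (Fin.forall_fin_two.mpr ⟨hab, hbc⟩)), rfl⟩
  · rintro ⟨l, hl⟩
    have h01 : (⟨0, by omega⟩ : Fin (l.length + 1)) < ⟨1, by omega⟩ := by simp [Fin.lt_def]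
    have h12 : (⟨1, by omega⟩ : Fin (l.length + 1)) < ⟨2, by omega⟩ := by simp [Fin.lt_def]
    exact ⟨_, (l ⟨0, by omega⟩).2, _, _, l.strictMono h01, l.strictMono h12⟩

lemma Module.support_finite_of_semilocal [IsNoetherianRing R]
    (hs : {I : Ideal R | I.IsMaximal}.Finite)
    (hA : (associatedPrimes R A).Finite)
    (hd : Order.krullDim (Module.support R A) < ((2 : ℕ) : WithBot ℕ∞)) :
    (Module.support R A).Finite := by
  rw [krullDim_support_lt_two_iff] at hd
  refine Set.Finite.of_finite_image (f := PrimeSpectrum.asIdeal) ((hA.union hs).subset ?_)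
    (fun _ _ _ _ h ↦ PrimeSpectrum.ext h)
  rintro _ ⟨p, hp, rfl⟩
  obtain ⟨q, hq, hqp⟩ := Module.exists_associatedPrime_le_of_mem_support hp
  rcases hqp.eq_or_lt with h | h
  · exact Or.inl (h ▸ hq)
  · right
    obtain ⟨m, hm, hpm⟩ := Ideal.exists_le_maximal _ p.2.ne_top
    rcases hpm.eq_or_lt with h' | h'
    · rwa [Set.mem_ofPred_eq, h']
    · exact absurd h' (hd _ (Module.mem_support_of_mem_associatedPrimes hq) p ⟨m, hm.isPrime⟩ h)

end Skinny

section InDim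

variable {R : Type} [CommRing R]

/-- In a Noetherian ring, infinitely many primes lie strictly between the ends of a chain of length
two. -/
lemma PrimeSpectrum.exists_between_notMem [IsNoetherianRing R] {p q r : PrimeSpectrum R}
    (hpq : p < q) (hqr : q < r) (s : Finset (PrimeSpectrum R)) :
    ∃ t : PrimeSpectrum R, p < t ∧ t < r ∧ t ∉ s := by
  classical
  by_contra! H
  let s' : Set (PrimeSpectrum R) := insert p {t | t ∈ s ∧ t < r}
  have hs' : s'.Finite := (s.finite_toSet.subset (fun t ht ↦ ht.1)).insert p
  obtain ⟨x, hxr, hx⟩ : ∃ x ∈ r.asIdeal, ∀ t ∈ s', x ∉ t.asIdeal := by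
    by_contra! hc
    have : ((r.asIdeal : Ideal R) : Set R) ⊆ ⋃ t ∈ s', (t.asIdeal : Set R) := by
      intro x hx
      obtain ⟨t, ht, hxt⟩ := hc x hx
      exact Set.mem_biUnion ht hxt
    rw [Ideal.subset_union_prime_finite hs' p p (fun i _ _ _ ↦ i.2)] at this
    obtain ⟨t, ht, hle⟩ := this
    rcases ht with rfl | ht
    · exact absurd (hpq.trans hqr) (not_lt_of_ge hle)
    · exact absurd ht.2 (not_lt_of_ge hle)
  have hle : p.asIdeal ⊔ Ideal.span {x} ≤ r.asIdeal :=
    sup_le (hpq.trans hqr).le ((Ideal.span_singleton_le_iff_mem _).mpr hxr)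
  obtain ⟨t, ht, htr⟩ := Ideal.exists_minimalPrimes_le hle
  have hpt : p.asIdeal ≤ t := le_sup_left.trans ht.1.2
  have hxt : x ∈ t := ht.1.2 (Ideal.mem_sup_right (Ideal.mem_span_singleton_self x))
  have hpt' : p < ⟨t, ht.1.1⟩ := lt_of_le_of_ne hpt
    (fun h ↦ hx p (Or.inl rfl) (by rw [h]; exact hxt))
  rcases htr.lt_or_eq with h | h
  · exact hx ⟨t, ht.1.1⟩ (Or.inr ⟨H _ hpt' h, h⟩) hxt
  · subst h
    have h1 := Ideal.map_height_le_one_of_mem_minimalPrimes ht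
    have hker : RingHom.ker (Ideal.Quotient.mk p.asIdeal) = p.asIdeal := Ideal.mk_ker
    have hp1 : (q.asIdeal.map (Ideal.Quotient.mk p.asIdeal)).IsPrime :=
      Ideal.map_isPrime_of_surjective Ideal.Quotient.mk_surjective (hker.trans_le hpq.le)
    have hp2 : (r.asIdeal.map (Ideal.Quotient.mk p.asIdeal)).IsPrime :=
      Ideal.map_isPrime_of_surjective Ideal.Quotient.mk_surjective (hker.trans_le hpt)
    have hcq : (q.asIdeal.map (Ideal.Quotient.mk p.asIdeal)).comap (Ideal.Quotient.mk p.asIdeal) =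
        q.asIdeal := by
      rw [Ideal.comap_map_of_surjective _ Ideal.Quotient.mk_surjective, ← RingHom.ker_eq_comap_bot,
        hker, sup_eq_left]
      exact hpq.le
    have hcr : (r.asIdeal.map (Ideal.Quotient.mk p.asIdeal)).comap (Ideal.Quotient.mk p.asIdeal) =
        r.asIdeal := by
      rw [Ideal.comap_map_of_surjective _ Ideal.Quotient.mk_surjective, ← RingHom.ker_eq_comap_bot,
        hker, sup_eq_left]
      exact hpt
    have hlt : q.asIdeal.map (Ideal.Quotient.mk p.asIdeal) <
        r.asIdeal.map (Ideal.Quotient.mk p.asIdeal) :=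
      lt_of_le_of_ne (Ideal.map_mono hqr.le) (fun h ↦ hqr.ne (PrimeSpectrum.ext
        (by rw [← hcq, ← hcr, h])))
    have h2 := (Ideal.height_le_iff (n := 1)).mp (by exact_mod_cast h1) _ hp1 hlt
    have h3 : (⊥ : Ideal (R ⧸ p.asIdeal)) < q.asIdeal.map (Ideal.Quotient.mk p.asIdeal) := by
      refine lt_of_le_of_ne bot_le (fun h ↦ hpq.ne (PrimeSpectrum.ext ?_))
      rw [← hcq, ← h, ← RingHom.ker_eq_comap_bot, hker]
    have h4 : (q.asIdeal.map (Ideal.Quotient.mk p.asIdeal)).height ≤ (0 : ℕ) := by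
      have h2' : (q.asIdeal.map (Ideal.Quotient.mk p.asIdeal)).height < 1 := by exact_mod_cast h2
      rw [Order.lt_one_iff] at h2'
      simp [h2']
    have h5 := Ideal.height_le_iff.mp h4 ⊥ inferInstance h3
    simp at h5

/-- Primes `p` with `dim R/p = 1`. -/
def PrimeSpectrum.IsCoheightOne (p : PrimeSpectrum R) : Prop :=
  (∃ q, p < q) ∧ ∀ q r : PrimeSpectrum R, p < q → ¬ q < r

lemma PrimeSpectrum.IsCoheightOne.eq_of_le {p q : PrimeSpectrum R} (hp : p.IsCoheightOne)
    (hq : q.IsCoheightOne) (h : p ≤ q) : p = q := by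
  by_contra hne
  obtain ⟨r, hr⟩ := hq.1
  exact hp.2 q r (lt_of_le_of_ne h hne) hr

variable {M : Type} [AddCommGroup M] [Module R M]

lemma Module.exists_isCoheightOne_mem_support [IsNoetherianRing R]
    (hM : ¬ Order.krullDim (Module.support R M) < ((2 : ℕ) : WithBot ℕ∞))
    (s : Finset (PrimeSpectrum R)) :
    ∃ q ∈ Module.support R M, q.IsCoheightOne ∧ q ∉ s := by
  rw [krullDim_support_lt_two_iff] at hM
  push Not at hM
  obtain ⟨I, ⟨p, hp, rfl, q, r, hpq, hqr⟩, hmax⟩ := WellFounded.has_min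
    (wellFounded_gt (α := Ideal R))
    {I | ∃ p ∈ Module.support R M, p.asIdeal = I ∧ ∃ q r : PrimeSpectrum R, p < q ∧ q < r}
    (by obtain ⟨p, hp, q, r, h, h'⟩ := hM
        exact ⟨_, p, hp, rfl, q, r, h, h'⟩)
  obtain ⟨t, hpt, htr, hts⟩ := PrimeSpectrum.exists_between_notMem hpq hqr s
  have ht := Module.mem_support_mono hpt.le hp
  exact ⟨t, ht, ⟨⟨r, htr⟩, fun a b ha hb ↦ hmax _ ⟨t, ht, rfl, a, b, ha, hb⟩ hpt⟩, hts⟩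

/-- The Artin-Rees lemma for nested finitely generated submodules. -/
lemma Submodule.FG.exists_pow_smul_inf_le [IsNoetherianRing R] (P : Ideal R) {A B : Submodule R M}
    (hB : B.FG) (hAB : A ≤ B) (k : ℕ) : ∃ n, 0 < n ∧ P ^ n • B ⊓ A ≤ P ^ k • A := by
  have : Module.Finite R B := Module.Finite.iff_fg.mpr hB
  obtain ⟨c, hc⟩ := P.exists_pow_inf_eq_pow_smul (A.comap B.subtype)
  refine ⟨c + k + 1, by omega, ?_⟩
  have h := congrArg (Submodule.map B.subtype) (hc (c + k + 1) (by omega))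
  rw [Submodule.map_inf _ B.injective_subtype, Submodule.map_smul'', Submodule.map_smul'',
    Submodule.map_top, Submodule.range_subtype, Submodule.map_comap_subtype,
    inf_eq_right.mpr hAB] at h
  rw [h]
  refine (Submodule.smul_mono (Ideal.pow_le_pow_right (by omega))
    ((Submodule.map_mono inf_le_right).trans ?_))
  rw [Submodule.map_comap_subtype]
  exact inf_le_right

/-- A finite stage in the construction of a submodule `N` such that `M ⧸ N` has infinitely many
associated primes. -/
structure AssStage (R M : Type) [CommRing R] [AddCommGroup M] [Module R M] where
  big : Submodule R M
  small : Submodule R M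
  primes : Finset (PrimeSpectrum R)
  fg : big.FG
  le : small ≤ big
  coheight : ∀ p ∈ primes, p.IsCoheightOne
  pow_le : ∃ k, (∏ p ∈ primes, p.asIdeal) ^ k • big ≤ small
  exists_colon : ∀ p ∈ primes, ∃ y ∈ big, ∀ r : R, r • y ∈ small ↔ r ∈ p.asIdeal

lemma AssStage.exists_next [IsNoetherianRing R] (hM : ¬ InDimLT R M 2) (S : AssStage R M) :
    ∃ T : AssStage R M, S.big ≤ T.big ∧ T.small ⊓ S.big = S.small ∧
      S.primes.card < T.primes.card := by
  classical
  have h : ¬ Order.krullDim (Module.support R (M ⧸ S.big)) < ((2 : ℕ) : WithBot ℕ∞) :=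
    fun h ↦ hM ⟨S.big, S.fg, h⟩
  obtain ⟨q, hq, hq1, hqs⟩ := Module.exists_isCoheightOne_mem_support h S.primes
  obtain ⟨x, hx⟩ := Module.mem_support_iff_exists_annihilator.mp hq
  obtain ⟨x, rfl⟩ := S.big.mkQ_surjective x
  have hx' : ∀ r : R, r • x ∈ S.big → r ∈ q.asIdeal := by
    intro r hr
    refine hx ((Submodule.mem_annihilator_span_singleton _ _).mpr ?_)
    rw [← map_smul, Submodule.mkQ_apply, Submodule.Quotient.mk_eq_zero]
    exact hr
  let B : Submodule R M := S.big ⊔ R ∙ x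
  have hB : B.FG := S.fg.sup (Submodule.fg_span_singleton x)
  have hAB : S.big ≤ B := le_sup_left
  have hxB : x ∈ B := Submodule.mem_sup_right (Submodule.mem_span_singleton_self x)
  let P : Ideal R := ∏ p ∈ S.primes, p.asIdeal
  obtain ⟨k, hk⟩ := S.pow_le
  obtain ⟨n, hn, hAR⟩ := hB.exists_pow_smul_inf_le P hAB k
  let N : Submodule R M := S.small ⊔ (P ^ n * q.asIdeal) • B
  have hNinf : N ⊓ S.big = S.small := by
    refine le_antisymm ?_ (le_inf le_sup_left S.le)
    change (S.small ⊔ (P ^ n * q.asIdeal) • B) ⊓ S.big ≤ S.small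
    rw [sup_inf_assoc_of_le _ S.le]
    refine sup_le le_rfl (((inf_le_inf_right _ (Submodule.smul_mono_left Ideal.mul_le_left)).trans
      hAR).trans hk)
  have hxN : ∀ r : R, r • x ∈ N → r ∈ q.asIdeal := by
    intro r hr
    have hN : N ≤ S.big ⊔ q.asIdeal • (R ∙ x) := by
      refine sup_le (S.le.trans le_sup_left)
        ((Submodule.smul_mono_left (J := q.asIdeal) Ideal.mul_le_right).trans ?_)
      rw [Submodule.smul_sup]
      exact sup_le_sup_right Submodule.smul_le_right _
    obtain ⟨a, ha, b, hb, hab⟩ := Submodule.mem_sup.mp (hN hr)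
    obtain ⟨c, hc, rfl⟩ := Submodule.mem_smul_span_singleton.mp hb
    have : r - c ∈ q.asIdeal := hx' _ (by rw [sub_smul, ← hab]; simpa using ha)
    simpa using add_mem this hc
  have hPq : ¬ P ^ n ≤ q.asIdeal := by
    intro h
    have h1 : P ≤ q.asIdeal := q.2.le_of_pow_le h
    obtain ⟨p, hp, hpq⟩ := (q.2.prod_le).mp h1
    have := (S.coheight p hp).eq_of_le hq1 hpq
    exact hqs (this ▸ hp)
  obtain ⟨z, hz, hzq⟩ := SetLike.not_le_iff_exists.mp hPq
  refine ⟨⟨B, N, insert q S.primes, hB, sup_le (S.le.trans hAB) Submodule.smul_le_right, ?_,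
    ⟨n, ?_⟩, ?_⟩, hAB, hNinf, ?_⟩
  · intro p hp
    rcases Finset.mem_insert.mp hp with rfl | hp
    exacts [hq1, S.coheight p hp]
  · rw [Finset.prod_insert hqs, mul_comm, mul_pow]
    exact (Submodule.smul_mono_left (Ideal.mul_mono_right (Ideal.pow_le_self hn.ne'))).trans
      le_sup_right
  · intro p hp
    rcases Finset.mem_insert.mp hp with rfl | hp
    · refine ⟨z • x, B.smul_mem z hxB, fun r ↦ ⟨fun hr ↦ ?_, fun hr ↦ ?_⟩⟩
      · rw [← mul_smul] at hr
        exact (p.2.mem_or_mem (hxN _ hr)).resolve_right hzq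
      · rw [← mul_smul]
        exact Submodule.mem_sup_right (Submodule.smul_mem_smul
          (mul_comm r z ▸ Ideal.mul_mem_mul hz hr) hxB)
    · obtain ⟨y, hy, hyr⟩ := S.exists_colon p hp
      refine ⟨y, hAB hy, fun r ↦ ⟨fun hr ↦ (hyr r).mp ?_, fun hr ↦ le_sup_left (a := S.small)
        ((hyr r).mpr hr)⟩⟩
      rw [← hNinf]
      exact ⟨hr, S.big.smul_mem r hy⟩
  · rw [Finset.card_insert_of_notMem hqs]
    exact Nat.lt_succ_self _

/-- Skinny modules over a Noetherian ring are in dimension `< 2`. -/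
theorem IsSkinny.inDimLT_two [IsNoetherianRing R] (h : IsSkinny R M) : InDimLT R M 2 := by
  classical
  by_contra hM
  choose next hbig hsmall hcard using AssStage.exists_next hM
  let S₀ : AssStage R M := ⟨⊥, ⊥, ∅, Submodule.fg_bot, le_rfl, by simp, ⟨0, by simp⟩, by simp⟩
  let S : ℕ → AssStage R M := fun n ↦ next^[n] S₀
  have hS : ∀ n, S (n + 1) = next (S n) := fun n ↦ Function.iterate_succ_apply' next n S₀
  have hbig' : Monotone fun n ↦ (S n).big := monotone_nat_of_le_succ fun n ↦ by
    rw [hS]; exact hbig _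
  have hsucc : ∀ n, (S (n + 1)).small ⊓ (S n).big = (S n).small := fun n ↦ by
    rw [hS]; exact hsmall _
  have hsmall' : Monotone fun n ↦ (S n).small := monotone_nat_of_le_succ fun n ↦ by
    rw [← hsucc]; exact inf_le_left
  have hinf : ∀ n m, (S (n + m)).small ⊓ (S n).big ≤ (S n).small := by
    intro n m
    induction m with
    | zero => exact inf_le_left
    | succ m ih =>
      refine le_trans (le_inf ?_ inf_le_right) ih
      rw [← hsucc (n + m)]
      exact le_inf inf_le_left (inf_le_right.trans (hbig' (Nat.le_add_right n m)))
  let N : Submodule R M := ⨆ n, (S n).small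
  have hN : ∀ n x, x ∈ (S n).big → x ∈ N → x ∈ (S n).small := by
    intro n x hx hxN
    obtain ⟨m, hm⟩ := (Submodule.mem_iSup_of_directed _ hsmall'.directed_le).mp hxN
    exact hinf n m ⟨hsmall' (Nat.le_add_left m n) hm, hx⟩
  have hass : ∀ n, ∀ p ∈ (S n).primes, p.asIdeal ∈ associatedPrimes R (M ⧸ N) := by
    intro n p hp
    obtain ⟨y, hy, hyr⟩ := (S n).exists_colon p hp
    refine isAssociatedPrime_iff.mpr ⟨p.2, N.mkQ y, ?_⟩
    ext r
    rw [Submodule.mem_colon_singleton, Submodule.mem_bot, ← map_smul, Submodule.mkQ_apply,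
      Submodule.Quotient.mk_eq_zero, ← hyr]
    exact ⟨fun h ↦ Submodule.mem_iSup_of_mem n h, hN n _ ((S n).big.smul_mem r hy)⟩
  have hcard' : ∀ n, n ≤ (S n).primes.card := by
    intro n
    induction n with
    | zero => exact Nat.zero_le _
    | succ n ih => rw [hS]; exact ih.trans_lt (hcard _)
  have hfin := h N
  have hle : ∀ n, (S n).primes.card ≤ hfin.toFinset.card := by
    intro n
    refine Finset.card_le_card_of_injOn PrimeSpectrum.asIdeal (fun p hp ↦ ?_)
      (fun _ _ _ _ h ↦ PrimeSpectrum.ext h)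
    exact hfin.mem_toFinset.mpr (hass n p hp)
  exact absurd ((hcard' _).trans (hle (hfin.toFinset.card + 1))) (by omega)

end InDim

section ExtComparison

open Opposite

variable {R : Type} [CommRing R] {X X' : ModuleCat.{0} R} (P : ProjectiveResolution X)
  (Q : ProjectiveResolution X') (Y : ModuleCat.{0} R) (n : ℕ)

namespace CategoryTheory.ProjectiveResolution

/-- The degree `n` cocycles of the complex of maps from a projective resolution to `Y`. -/
def extCocycles : Submodule R (P.complex.X n ⟶ Y) :=
  LinearMap.ker (Linear.leftComp R Y (P.complex.d (n + 1) n))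

variable {P Y n} in
lemma mem_extCocycles {f : P.complex.X n ⟶ Y} :
    f ∈ P.extCocycles Y n ↔ P.complex.d (n + 1) n ≫ f = 0 := Iff.rfl

/-- The complex of maps from a projective resolution to `Y`, in the opposite category. -/
abbrev homOpComplex : ChainComplex (ModuleCat.{0} R)ᵒᵖ ℕ :=
  (((linearYoneda R (ModuleCat.{0} R)).obj Y).rightOp.mapHomologicalComplex _).obj P.complex

lemma homOpComplex_d_comp_subtype : (P.homOpComplex Y).d (n + 1) n ≫
    (ModuleCat.ofHom (P.extCocycles Y n).subtype).op = 0 := by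
  apply Quiver.Hom.unop_inj
  ext z
  exact z.2

/-- The comparison map from cocycles to the opposite of the opcycles. -/
def opcyclesToCocycles : (P.homOpComplex Y).opcycles n ⟶ op (ModuleCat.of R (P.extCocycles Y n)) :=
  (P.homOpComplex Y).descOpcycles (ModuleCat.ofHom (P.extCocycles Y n).subtype).op (n + 1)
    (by simp) (P.homOpComplex_d_comp_subtype Y n)

lemma pOpcycles_opcyclesToCocycles : (P.homOpComplex Y).pOpcycles n ≫ P.opcyclesToCocycles Y n =
    (ModuleCat.ofHom (P.extCocycles Y n).subtype).op :=
  HomologicalComplex.p_descOpcycles ..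

lemma opcyclesToCocycles_unop_surjective :
    Function.Surjective (P.opcyclesToCocycles Y n).unop.hom := by
  intro c
  have hinj : Function.Injective ((P.homOpComplex Y).pOpcycles n).unop.hom :=
    (ModuleCat.mono_iff_injective _).mp inferInstance
  let z : P.complex.X n ⟶ Y := ((P.homOpComplex Y).pOpcycles n).unop.hom c
  have hz : z ∈ P.extCocycles Y n := by
    have h := congr_arg Quiver.Hom.unop ((P.homOpComplex Y).d_pOpcycles (n + 1) n)
    exact congr_arg (fun f ↦ f.hom c) h
  refine ⟨⟨z, hz⟩, hinj ?_⟩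
  have h := congr_arg Quiver.Hom.unop (P.pOpcycles_opcyclesToCocycles Y n)
  exact congr_arg (fun f ↦ f.hom (⟨z, hz⟩ : P.extCocycles Y n)) h

/-- The class in the left derived `Ext` of a cocycle. -/
def leftDerivedExtMk : P.extCocycles Y n →ₗ[R]
    ((_root_.Ext R (ModuleCat.{0} R) n).obj (op X)).obj Y :=
  ((P.isoLeftDerivedObj ((linearYoneda R (ModuleCat.{0} R)).obj Y).rightOp n).hom ≫
    (P.homOpComplex Y).homologyι n ≫ P.opcyclesToCocycles Y n).unop.hom

lemma leftDerivedExtMk_surjective : Function.Surjective (P.leftDerivedExtMk Y n) := by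
  have h1 : Function.Surjective ((P.homOpComplex Y).homologyι n).unop.hom :=
    (ModuleCat.epi_iff_surjective _).mp inferInstance
  have h2 : Function.Surjective
      (P.isoLeftDerivedObj ((linearYoneda R (ModuleCat.{0} R)).obj Y).rightOp n).hom.unop.hom :=
    (ModuleCat.epi_iff_surjective _).mp inferInstance
  exact h2.comp (h1.comp (P.opcyclesToCocycles_unop_surjective Y n))

lemma leftDerivedExtMk_eq_zero_iff (f : P.extCocycles Y n) :
    P.leftDerivedExtMk Y n f = 0 ↔ ∃ g : P.complex.X ((ComplexShape.down ℕ).next n) ⟶ Y,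
      P.complex.d n _ ≫ g = f := by
  have h2 : Function.Injective
      (P.isoLeftDerivedObj ((linearYoneda R (ModuleCat.{0} R)).obj Y).rightOp n).hom.unop.hom :=
    (ModuleCat.mono_iff_injective _).mp inferInstance
  have hinj : Function.Injective ((P.homOpComplex Y).pOpcycles n).unop.hom :=
    (ModuleCat.mono_iff_injective _).mp inferInstance
  have hp : ∀ f, ((P.homOpComplex Y).pOpcycles n).unop.hom
      ((P.opcyclesToCocycles Y n).unop.hom f) = (f : P.complex.X n ⟶ Y) := fun f ↦
    congr_arg (fun g ↦ g.hom f)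
      (congr_arg Quiver.Hom.unop (P.pOpcycles_opcyclesToCocycles Y n))
  have hd : ∀ g : P.complex.X ((ComplexShape.down ℕ).next n) ⟶ Y,
      ((P.homOpComplex Y).pOpcycles n).unop.hom
      (((P.homOpComplex Y).fromOpcycles n _).unop.hom g) = P.complex.d n _ ≫ g := fun g ↦
    congr_arg (fun h ↦ h.hom g)
      (congr_arg Quiver.Hom.unop ((P.homOpComplex Y).p_fromOpcycles n _))
  let S : ShortComplex (ModuleCat.{0} R)ᵒᵖ := ShortComplex.mk _ _
    ((P.homOpComplex Y).homologyι_comp_fromOpcycles n ((ComplexShape.down ℕ).next n))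
  have hS : S.Exact := S.exact_of_f_is_kernel ((P.homOpComplex Y).homologyIsKernel n _ rfl)
  have hS' := (ShortComplex.ShortExact.moduleCat_exact_iff_function_exact S.unop).mp hS.unop
  have h3 : P.leftDerivedExtMk Y n f = 0 ↔
      ((P.homOpComplex Y).homologyι n).unop.hom ((P.opcyclesToCocycles Y n).unop.hom f) = 0 :=
    map_eq_zero_iff _ h2
  rw [h3]
  refine (hS' _).trans ⟨?_, ?_⟩
  · rintro ⟨g, hg⟩
    exact ⟨g, (hd g).symm.trans ((congr_arg _ hg).trans (hp f))⟩
  · rintro ⟨g, hg⟩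
    exact ⟨g, hinj ((hd g).trans (hg.trans (hp f).symm))⟩

lemma leftDerivedExtMk_naturality (g : X' ⟶ X) (φ : Hom Q P g) (f : P.extCocycles Y n)
    (hf : φ.hom.f n ≫ f.1 ∈ Q.extCocycles Y n) :
    (((_root_.Ext R (ModuleCat.{0} R) n).map g.op).app Y).hom (P.leftDerivedExtMk Y n f) =
      Q.leftDerivedExtMk Y n ⟨_, hf⟩ := by
  have hinj : Function.Injective ((Q.homOpComplex Y).pOpcycles n).unop.hom :=
    (ModuleCat.mono_iff_injective _).mp inferInstance
  have h1 := Q.isoLeftDerivedObj_hom_naturality g P φ.hom (by simpa using φ.hom_f_zero_comp_π_f_zero)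
    ((linearYoneda R (ModuleCat.{0} R)).obj Y).rightOp n
  have h1' := congr_arg (fun g ↦ g.hom
    (((P.homOpComplex Y).homologyι n ≫ P.opcyclesToCocycles Y n).unop.hom f))
    (congr_arg Quiver.Hom.unop h1)
  refine h1'.trans (congr_arg (Q.isoLeftDerivedObj
    ((linearYoneda R (ModuleCat.{0} R)).obj Y).rightOp n).hom.unop.hom ?_)
  have h2 := HomologicalComplex.homologyι_naturality
    (((((linearYoneda R (ModuleCat.{0} R)).obj Y).rightOp).mapHomologicalComplex _).map φ.hom) n
  refine (congr_arg (fun g ↦ g.hom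
    ((P.opcyclesToCocycles Y n).unop.hom f)) (congr_arg Quiver.Hom.unop h2)).trans ?_
  refine congr_arg ((Q.homOpComplex Y).homologyι n).unop.hom (hinj ?_)
  have h3 := HomologicalComplex.p_opcyclesMap
    (((((linearYoneda R (ModuleCat.{0} R)).obj Y).rightOp).mapHomologicalComplex _).map φ.hom) n
  refine (congr_arg (fun g ↦ g.hom
    ((P.opcyclesToCocycles Y n).unop.hom f)) (congr_arg Quiver.Hom.unop h3)).trans ?_
  have hp := congr_arg (fun g ↦ g.hom f)
      (congr_arg Quiver.Hom.unop (P.pOpcycles_opcyclesToCocycles Y n))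
  have hq := congr_arg (fun g ↦ g.hom (⟨_, hf⟩ : Q.extCocycles Y n))
      (congr_arg Quiver.Hom.unop (Q.pOpcycles_opcyclesToCocycles Y n))
  refine Eq.trans ?_ hq.symm
  exact congr_arg (fun h ↦ φ.hom.f n ≫ h) hp

variable {Y n} in
lemma extMk_smul (f : P.complex.X n ⟶ Y) (hf : P.complex.d (n + 1) n ≫ f = 0) (r : R) :
    P.extMk (r • f) (n + 1) rfl (by rw [Linear.comp_smul, hf, smul_zero]) =
      r • P.extMk f (n + 1) rfl hf := by
  rw [Abelian.Ext.smul_eq_comp_mk₀, extMk_comp_mk₀]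
  simp

variable {Y} in
lemma eq_zero_of_extMk_eq_zero (f : P.complex.X 0 ⟶ Y) (hf : P.complex.d 1 0 ≫ f = 0)
    (h : P.extMk f 1 rfl hf = 0) : f = 0 := by
  rw [← P.extEquivCohomologyClass.apply_eq_iff_eq,
    extEquivCohomologyClass_extMk, extEquivCohomologyClass_zero,
    CochainComplex.HomComplex.CohomologyClass.mk_eq_zero_iff,
    CochainComplex.HomComplex.Cocycle.toSingleMk_mem_coboundaries_iff _ _ _ _ _ 1 (by lia)] at h
  obtain ⟨g, hg⟩ := h
  rw [← cancel_epi (P.cochainComplexXIso (-0) 0 rfl).hom, Limits.comp_zero]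
  refine hg.symm.trans ?_
  have hg0 : g = 0 := (P.cochainComplex.isZero_of_isStrictlyLE 0 1 (by lia)).eq_of_src _ _
  rw [hg0, Limits.comp_zero]

/-- The class in `Abelian.Ext` of a cocycle. -/
def abelianExtMk : P.extCocycles Y n →ₗ[R] Abelian.Ext X Y n where
  toFun f := P.extMk f.1 (n + 1) rfl f.2
  map_add' _ _ := (P.add_extMk _ _ _ _ _ _).symm
  map_smul' r f := P.extMk_smul f.1 f.2 r

lemma abelianExtMk_surjective : Function.Surjective (P.abelianExtMk Y n) := fun x ↦ by
  obtain ⟨f, hf, rfl⟩ := P.extMk_surjective x (n + 1) rfl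
  exact ⟨⟨f, hf⟩, rfl⟩

lemma abelianExtMk_eq_zero_iff (f : P.extCocycles Y n) :
    P.abelianExtMk Y n f = 0 ↔ ∃ g : P.complex.X ((ComplexShape.down ℕ).next n) ⟶ Y,
      P.complex.d n _ ≫ g = f := by
  cases n with
  | succ n =>
    rw [(ComplexShape.down ℕ).next_eq' (j := n) (by simp)]
    exact P.extMk_eq_zero_iff f.1 (n + 2) rfl f.2 n rfl
  | zero =>
    have hd : P.complex.d 0 ((ComplexShape.down ℕ).next 0) = 0 :=
      P.complex.shape _ _ (by simp)
    simp only [hd, Limits.zero_comp, exists_const]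
    refine ⟨fun h ↦ (P.eq_zero_of_extMk_eq_zero f.1 f.2 h).symm, fun h ↦ ?_⟩
    · obtain rfl : f = 0 := Subtype.ext h.symm
      exact map_zero _

/-- The left derived `Ext` agrees with `Abelian.Ext`. -/
def leftDerivedExtEquiv : ((_root_.Ext R (ModuleCat.{0} R) n).obj (op X)).obj Y ≃ₗ[R]
    Abelian.Ext X Y n :=
  ((P.leftDerivedExtMk Y n).quotKerEquivOfSurjective (P.leftDerivedExtMk_surjective Y n)).symm.trans
    ((Submodule.quotEquivOfEq _ _ (by
      ext f
      rw [LinearMap.mem_ker, LinearMap.mem_ker, leftDerivedExtMk_eq_zero_iff,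
        abelianExtMk_eq_zero_iff])).trans
      ((P.abelianExtMk Y n).quotKerEquivOfSurjective (P.abelianExtMk_surjective Y n)))

lemma leftDerivedExtEquiv_leftDerivedExtMk (f : P.extCocycles Y n) :
    P.leftDerivedExtEquiv Y n (P.leftDerivedExtMk Y n f) = P.abelianExtMk Y n f := by
  have : ((P.leftDerivedExtMk Y n).quotKerEquivOfSurjective
      (P.leftDerivedExtMk_surjective Y n)).symm (P.leftDerivedExtMk Y n f) =
      Submodule.Quotient.mk f := by
    rw [LinearEquiv.symm_apply_eq]
    rfl
  simp only [leftDerivedExtEquiv, LinearEquiv.trans_apply, this]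
  rfl

lemma leftDerivedExtEquiv_naturality (g : X' ⟶ X)
    (x : ((_root_.Ext R (ModuleCat.{0} R) n).obj (op X)).obj Y) :
    Q.leftDerivedExtEquiv Y n ((((_root_.Ext R (ModuleCat.{0} R) n).map g.op).app Y).hom x) =
      (Abelian.Ext.mk₀ g).comp (P.leftDerivedExtEquiv Y n x) (zero_add n) := by
  obtain ⟨f, rfl⟩ := P.leftDerivedExtMk_surjective Y n x
  let φ : Hom Q P g := ⟨lift g Q P, lift_commutes_zero g Q P⟩
  have hf : φ.hom.f n ≫ f.1 ∈ Q.extCocycles Y n := by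
    rw [mem_extCocycles, ← φ.hom.comm_assoc, mem_extCocycles.mp f.2, Limits.comp_zero]
  rw [P.leftDerivedExtMk_naturality Q Y n g φ f hf, leftDerivedExtEquiv_leftDerivedExtMk,
    leftDerivedExtEquiv_leftDerivedExtMk]
  exact (mk₀_comp_extMk f.1 (n + 1) rfl f.2 φ).symm

end CategoryTheory.ProjectiveResolution
end ExtComparison

section LocCohColimit

open Opposite Limits

variable {R : Type} [CommRing R] (a : Ideal R)

/-- The module `R / a ^ n`. -/
abbrev powQuot (n : ℕ) : ModuleCat.{0} R := ModuleCat.of R (R ⧸ a ^ n)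

/-- The projection `R / a ^ m ⟶ R / a ^ n` for `n ≤ m`. -/
def powQuotMap {n m : ℕ} (h : n ≤ m) : powQuot a m ⟶ powQuot a n :=
  ModuleCat.ofHom (Submodule.mapQ _ _ LinearMap.id (Ideal.pow_le_pow_right h))

variable (i : ℕ) (M : Type) [AddCommGroup M] [Module R M]

/-- The diagram of modules whose colimit is local cohomology. -/
abbrev locCohDiagram : ℕᵒᵖᵒᵖ ⥤ ModuleCat.{0} R :=
  localCohomology.diagram (localCohomology.idealPowersDiagram a) i ⋙
    (evaluation _ _).obj (ModuleCat.of R M)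

/-- The cocone exhibiting local cohomology as a colimit. -/
def locCohCocone : Cocone (locCohDiagram a i M) :=
  ((evaluation _ _).obj (ModuleCat.of R M)).mapCocone
    (colimit.cocone (localCohomology.diagram (localCohomology.idealPowersDiagram a) i))

/-- Local cohomology is a colimit. -/
def locCohIsColimit : IsColimit (locCohCocone a i M) :=
  isColimitOfPreserves ((evaluation _ _).obj (ModuleCat.of R M)) (colimit.isColimit _)

/-- The comparison of the terms of the diagram with `Abelian.Ext`. -/
def powQuotExtEquiv (n : ℕ) : (locCohDiagram a i M).obj (op (op n)) ≃ₗ[R]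
    Abelian.Ext (powQuot a n) (ModuleCat.of R M) i :=
  (projectiveResolution (powQuot a n)).leftDerivedExtEquiv (ModuleCat.of R M) i

lemma powQuotExtEquiv_map {n m : ℕ} (h : n ≤ m) (x : (locCohDiagram a i M).obj (op (op n))) :
    powQuotExtEquiv a i M m ((locCohDiagram a i M).map (homOfLE h).op.op x) =
      (Abelian.Ext.mk₀ (powQuotMap a h)).comp (powQuotExtEquiv a i M n x) (zero_add i) :=
  ProjectiveResolution.leftDerivedExtEquiv_naturality _ _ _ i (powQuotMap a h) x

/-- The canonical map from `Ext (R / a ^ n) M i` to local cohomology. -/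
def locCohι (n : ℕ) : Abelian.Ext (powQuot a n) (ModuleCat.of R M) i →ₗ[R] locCoh R a i M :=
  ((locCohCocone a i M).ι.app (op (op n))).hom ∘ₗ (powQuotExtEquiv a i M n).symm.toLinearMap

lemma locCohι_powQuotExtEquiv (n : ℕ) (x : (locCohDiagram a i M).obj (op (op n))) :
    locCohι a i M n (powQuotExtEquiv a i M n x) = (locCohCocone a i M).ι.app (op (op n)) x :=
  congr_arg ((locCohCocone a i M).ι.app (op (op n))).hom
    ((powQuotExtEquiv a i M n).symm_apply_apply x)

variable {a i M}

lemma locCohι_comp {n m : ℕ} (h : n ≤ m) (e : Abelian.Ext (powQuot a n) (ModuleCat.of R M) i) :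
    locCohι a i M m ((Abelian.Ext.mk₀ (powQuotMap a h)).comp e (zero_add i)) =
      locCohι a i M n e := by
  obtain ⟨x, rfl⟩ := (powQuotExtEquiv a i M n).surjective e
  rw [← powQuotExtEquiv_map, locCohι_powQuotExtEquiv, locCohι_powQuotExtEquiv]
  exact congr_arg (fun f ↦ f.hom x) ((locCohCocone a i M).w (homOfLE h).op.op)

lemma exists_locCohι_eq (x : locCoh R a i M) : ∃ n e, locCohι a i M n e = x := by
  obtain ⟨j, y, hy⟩ := Concrete.isColimit_exists_rep _ (locCohIsColimit a i M) x
  exact ⟨j.unop.unop, powQuotExtEquiv a i M _ y,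
    (locCohι_powQuotExtEquiv a i M _ y).trans hy⟩

lemma exists_comp_eq_zero_of_locCohι_eq_zero {n : ℕ}
    (e : Abelian.Ext (powQuot a n) (ModuleCat.of R M) i) (he : locCohι a i M n e = 0) :
    ∃ (m : ℕ) (h : n ≤ m), (Abelian.Ext.mk₀ (powQuotMap a h)).comp e (zero_add i) = 0 := by
  obtain ⟨x, rfl⟩ := (powQuotExtEquiv a i M n).surjective e
  rw [locCohι_powQuotExtEquiv] at he
  have h0 : (locCohCocone a i M).ι.app (op (op n)) x =
      (locCohCocone a i M).ι.app (op (op n)) 0 := he.trans (map_zero _).symm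
  obtain ⟨k, f, g, hfg⟩ := (Concrete.isColimit_rep_eq_iff_exists _ (locCohIsColimit a i M) _ _).mp h0
  have h : n ≤ k.unop.unop := leOfHom f.unop.unop
  refine ⟨k.unop.unop, h, ?_⟩
  rw [← powQuotExtEquiv_map]
  have h1 : (locCohDiagram a i M).map f x = 0 := hfg.trans (map_zero _)
  exact (congr_arg _ h1).trans (map_zero _)

end LocCohColimit

section PowTorsion

variable {R : Type} [CommRing R] (a : Ideal R) (X : Type) [AddCommGroup X] [Module R X]

/-- The submodule of elements killed by some power of the ideal `a`. -/
def powTorsion : Submodule R X where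
  carrier := {x | ∃ n, ∀ r ∈ a ^ n, r • x = 0}
  zero_mem' := ⟨0, fun _ _ ↦ smul_zero _⟩
  add_mem' := by
    rintro x y ⟨n, hn⟩ ⟨m, hm⟩
    refine ⟨max n m, fun r hr ↦ ?_⟩
    rw [smul_add, hn r (Ideal.pow_le_pow_right (le_max_left _ _) hr),
      hm r (Ideal.pow_le_pow_right (le_max_right _ _) hr), add_zero]
  smul_mem' := by
    rintro c x ⟨n, hn⟩
    exact ⟨n, fun r hr ↦ by rw [smul_comm, hn r hr, smul_zero]⟩

variable {a X}

lemma exists_pow_smul_eq_zero_of_fg {N : Submodule R X} (hN : N.FG) (h : N ≤ powTorsion a X) :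
    ∃ n, ∀ r ∈ a ^ n, ∀ x ∈ N, r • x = 0 := by
  induction N, hN using Submodule.fg_induction with
  | singleton x =>
    obtain ⟨n, hn⟩ := h (Submodule.mem_span_singleton_self x)
    refine ⟨n, fun r hr y hy ↦ ?_⟩
    obtain ⟨c, rfl⟩ := Submodule.mem_span_singleton.mp hy
    rw [smul_comm, hn r hr, smul_zero]
  | sup N₁ N₂ _ _ h₁ h₂ =>
    obtain ⟨n, hn⟩ := h₁ (le_sup_left.trans h)
    obtain ⟨m, hm⟩ := h₂ (le_sup_right.trans h)
    refine ⟨max n m, fun r hr x hx ↦ ?_⟩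
    obtain ⟨y, hy, z, hz, rfl⟩ := Submodule.mem_sup.mp hx
    rw [smul_add, hn r (Ideal.pow_le_pow_right (le_max_left _ _) hr) y hy,
      hm r (Ideal.pow_le_pow_right (le_max_right _ _) hr) z hz, add_zero]

variable [IsNoetherianRing R]

instance injective_powTorsion [Module.Injective R X] :
    Module.Injective R (powTorsion a X) := by
  refine Module.Baer.injective fun I g ↦ ?_
  obtain ⟨n, hn⟩ := exists_pow_smul_eq_zero_of_fg (a := a)
    (N := (LinearMap.range ((powTorsion a X).subtype ∘ₗ g)))
    (by rw [LinearMap.range_eq_map]; exact (Module.Finite.fg_top (R := R) (M := I)).map _)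
    (by rintro _ ⟨y, rfl⟩; exact (g y).2)
  obtain ⟨k, -, hk⟩ := Submodule.FG.exists_pow_smul_inf_le a (A := I) (B := ⊤)
    Module.Finite.fg_top le_top n
  let f : I →ₗ[R] R ⧸ a ^ k := (a ^ k).mkQ ∘ₗ I.subtype
  have hf : LinearMap.ker f ≤ LinearMap.ker ((powTorsion a X).subtype ∘ₗ g) := by
    rintro ⟨y, hyI⟩ hy
    have hy' : y ∈ a ^ k := (Submodule.Quotient.mk_eq_zero _).mp hy
    have hy2 : y ∈ a ^ n • I := hk ⟨by simpa using hy', hyI⟩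
    have key : ∀ z (_ : z ∈ a ^ n • I) (hz' : z ∈ I), (g ⟨z, hz'⟩ : X) = 0 := by
      intro z hz hz'
      have : ∃ w : I, w.1 = z ∧ (g w : X) = 0 := by
        refine Submodule.smul_induction_on hz (fun r hr c hc ↦ ⟨r • ⟨c, hc⟩, rfl, ?_⟩) ?_
        · rw [map_smul]
          exact hn r hr _ ⟨⟨c, hc⟩, rfl⟩
        · rintro _ _ ⟨w, rfl, hw⟩ ⟨w', rfl, hw'⟩
          exact ⟨w + w', rfl, by rw [map_add, Submodule.coe_add, hw, hw', add_zero]⟩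
      obtain ⟨w, rfl, hw⟩ := this
      exact hw
    exact key y hy2 hyI
  obtain ⟨h, hh⟩ := Module.Injective.out (Q := X) ((LinearMap.ker f).liftQ f le_rfl)
    (LinearMap.ker_eq_bot.mp (Submodule.ker_liftQ_eq_bot _ _ _ le_rfl))
    ((LinearMap.ker f).liftQ _ hf)
  have hmem : ∀ x, h x ∈ powTorsion a X := by
    intro x
    refine ⟨k, fun r hr ↦ ?_⟩
    have : r • x = 0 := by
      obtain ⟨y, rfl⟩ := Submodule.Quotient.mk_surjective _ x
      exact (Submodule.Quotient.mk_eq_zero _).mpr (Ideal.mul_mem_right _ _ hr)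
    rw [← map_smul, this, map_zero]
  refine ⟨(h.codRestrict _ hmem) ∘ₗ (a ^ k).mkQ, fun x hx ↦ Subtype.ext ?_⟩
  exact hh (Submodule.Quotient.mk ⟨x, hx⟩)

instance injective_quotient_powTorsion [Module.Injective R X] :
    Module.Injective R (X ⧸ powTorsion a X) := by
  obtain ⟨r, hr⟩ := Module.Injective.out (powTorsion a X).subtype
    (Submodule.injective_subtype _) (LinearMap.id)
  let s : (X ⧸ powTorsion a X) →ₗ[R] X := Submodule.liftQ _
    (LinearMap.id - (powTorsion a X).subtype ∘ₗ r) (by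
      intro x hx
      have : r x = ⟨x, hx⟩ := hr ⟨x, hx⟩
      simp [this])
  have hs : ∀ y, Submodule.Quotient.mk (s y) = y := by
    intro y
    obtain ⟨y, rfl⟩ := Submodule.Quotient.mk_surjective _ y
    refine (Submodule.Quotient.eq _).mpr ?_
    simp [s]
  refine ⟨fun A B _ _ _ _ f hf g ↦ ?_⟩
  obtain ⟨h, hh⟩ := Module.Injective.out f hf (s ∘ₗ g)
  exact ⟨(powTorsion a X).mkQ ∘ₗ h, fun x ↦ by simp [hh, hs]⟩

variable (a X) in
lemma powTorsion_quotient_eq_bot : powTorsion a (X ⧸ powTorsion a X) = ⊥ := by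
  rw [eq_bot_iff]
  rintro y ⟨n, hn⟩
  obtain ⟨x, rfl⟩ := Submodule.Quotient.mk_surjective _ y
  obtain ⟨m, hm⟩ := exists_pow_smul_eq_zero_of_fg (a := a)
    (N := Submodule.map (LinearMap.toSpanSingleton R X x) (a ^ n))
    (Submodule.FG.map _ (IsNoetherian.noetherian (a ^ n)))
    (by
      rintro _ ⟨r, hr, rfl⟩
      exact (Submodule.Quotient.mk_eq_zero _).mp (hn r hr))
  refine (Submodule.Quotient.mk_eq_zero _).mpr ⟨m + n, fun r hr ↦ ?_⟩
  rw [pow_add] at hr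
  refine Submodule.mul_induction_on hr (fun s hs t ht ↦ ?_) (fun s t hs ht ↦ ?_)
  · rw [mul_smul]
    exact hm s hs _ ⟨t, ht, rfl⟩
  · rw [add_smul, hs, ht, add_zero]

variable (a) in
lemma exists_injective_powTorsion_eq_bot (h : powTorsion a X = ⊥) :
    ∃ (E : Type) (_ : AddCommGroup E) (_ : Module R E) (_ : Module.Injective R E)
      (f : X →ₗ[R] E), Function.Injective f ∧ powTorsion a E = ⊥ := by
  let E₀ := Injective.under (ModuleCat.of R X)
  have : CategoryTheory.Injective (ModuleCat.of R E₀) :=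
    inferInstanceAs (CategoryTheory.Injective E₀)
  have : Module.Injective R E₀ := Module.injective_module_of_injective_object R E₀
  have hf : Function.Injective (Injective.ι (ModuleCat.of R X)).hom :=
    (ModuleCat.mono_iff_injective _).mp inferInstance
  refine ⟨E₀ ⧸ powTorsion a E₀, inferInstance, inferInstance, inferInstance,
    (powTorsion a E₀).mkQ ∘ₗ (Injective.ι (ModuleCat.of R X)).hom, ?_,
    powTorsion_quotient_eq_bot a E₀⟩
  rw [injective_iff_map_eq_zero]
  intro x hx
  obtain ⟨n, hn⟩ := (Submodule.Quotient.mk_eq_zero _).mp hx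
  have : x ∈ powTorsion a X := ⟨n, fun r hr ↦ hf (by rw [map_smul, map_zero]; exact hn r hr)⟩
  rwa [h] at this

variable (a) in
lemma exists_injective_powTorsion_eq_top (h : powTorsion a X = ⊤) :
    ∃ (E : Type) (_ : AddCommGroup E) (_ : Module R E) (_ : Module.Injective R E)
      (f : X →ₗ[R] E), Function.Injective f ∧ powTorsion a E = ⊤ := by
  let E₀ := Injective.under (ModuleCat.of R X)
  have : CategoryTheory.Injective (ModuleCat.of R E₀) :=
    inferInstanceAs (CategoryTheory.Injective E₀)
  have : Module.Injective R E₀ := Module.injective_module_of_injective_object R E₀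
  have hf : Function.Injective (Injective.ι (ModuleCat.of R X)).hom :=
    (ModuleCat.mono_iff_injective _).mp inferInstance
  refine ⟨powTorsion a E₀, inferInstance, inferInstance, inferInstance,
    (Injective.ι (ModuleCat.of R X)).hom.codRestrict _ (fun x ↦ ?_),
    fun x y hxy ↦ hf (congr_arg Subtype.val hxy), ?_⟩
  · obtain ⟨n, hn⟩ : x ∈ powTorsion a X := h ▸ Submodule.mem_top
    exact ⟨n, fun r hr ↦ by rw [← map_smul, hn r hr, map_zero]⟩
  · rw [eq_top_iff]
    rintro ⟨x, n, hn⟩ -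
    exact ⟨n, fun r hr ↦ Subtype.ext (hn r hr)⟩

end PowTorsion

section SkinnyExt

variable {R : Type} [CommRing R]

/-- The short complex `0 ⟶ A ⟶ B ⟶ B / f(A) ⟶ 0` attached to a linear map `f : A → B`. -/
abbrev cokerShortComplex {A B : Type} [AddCommGroup A] [Module R A] [AddCommGroup B] [Module R B]
    (f : A →ₗ[R] B) : ShortComplex (ModuleCat.{0} R) :=
  ShortComplex.mk (X₁ := ModuleCat.of R A) (X₂ := ModuleCat.of R B)
    (X₃ := ModuleCat.of R (B ⧸ LinearMap.range f)) (ModuleCat.ofHom f)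
    (ModuleCat.ofHom (LinearMap.range f).mkQ) (by ext x; simp)

lemma shortExact_cokerShortComplex {A B : Type} [AddCommGroup A] [Module R A] [AddCommGroup B]
    [Module R B] {f : A →ₗ[R] B} (hf : Function.Injective f) :
    (cokerShortComplex f).ShortExact where
  exact := (ShortComplex.ShortExact.moduleCat_exact_iff_function_exact _).mpr
    (LinearMap.exact_map_mkQ_range f)
  mono_f := (ModuleCat.mono_iff_injective _).mpr hf
  epi_g := (ModuleCat.epi_iff_surjective _).mpr (Submodule.mkQ_surjective _)

lemma injective_ext_zero_comp_mk₀ (N : ModuleCat.{0} R) {Y Z : ModuleCat.{0} R} (f : Y ⟶ Z)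
    (hf : Function.Injective f.hom) :
    Function.Injective ((Abelian.Ext.mk₀ f).postcompOfLinear R N (add_zero 0)) := by
  have : Mono f := (ModuleCat.mono_iff_injective _).mpr hf
  exact Abelian.Ext.postcomp_mk₀_injective_of_mono N f

lemma IsSkinny.pi {Y : Type} [AddCommGroup Y] [Module R Y] (h : IsSkinny R Y) (m : ℕ) :
    IsSkinny R (Fin m → Y) := by
  induction m with
  | zero => exact h.of_injective (0 : (Fin 0 → Y) →ₗ[R] Y) (Function.injective_of_subsingleton _)
  | succ m ih =>
    refine IsSkinny.of_exact h ih (LinearMap.single R (fun _ : Fin (m + 1) ↦ Y) 0)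
      (LinearMap.funLeft R Y Fin.succ) fun y ↦ ⟨fun hy ↦ ⟨y 0, ?_⟩, ?_⟩
    · ext i
      refine Fin.cases (by simp) (fun i ↦ ?_) i
      simpa using (congr_fun hy i).symm
    · rintro ⟨z, rfl⟩
      ext i
      simp [LinearMap.funLeft]

lemma IsSkinny.ext [IsNoetherianRing R] (N Y : ModuleCat.{0} R) [Module.Finite R N]
    (h : IsSkinny R Y) (i : ℕ) : IsSkinny R (Abelian.Ext N Y i) := by
  induction i generalizing N with
  | zero =>
    refine IsSkinny.of_injective (B := N →ₗ[R] Y) ?_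
      (Abelian.Ext.linearEquiv₀.trans ModuleCat.homLinearEquiv).toLinearMap
      (LinearEquiv.injective _)
    obtain ⟨m, f, hf⟩ := Module.Finite.exists_fin' R N
    refine (h.pi m).of_injective
      (LinearMap.pi fun i ↦ LinearMap.applyₗ (f (Pi.single i 1))) fun φ ψ hφψ ↦ ?_
    have : φ ∘ₗ f = ψ ∘ₗ f := by
      ext i
      simpa using congr_fun hφψ i
    exact (LinearMap.cancel_right hf).mp this
  | succ n ih =>
    obtain ⟨P, _, _, _, _, f, surjf⟩ := Module.exists_finite_presentation R N
    let exac := LinearMap.shortExact_shortComplexKer surjf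
    exact (ih _).of_surjective (exac.extClass.precompOfLinear R Y (add_comm 1 n))
      (precomp_extClass_surjective_of_projective_X₂ Y exac n)

end SkinnyExt

section LocCohDesc

open Opposite Limits

variable {R : Type} [CommRing R] {a : Ideal R} {i : ℕ} {M : Type} [AddCommGroup M] [Module R M]

/-- The universal property of local cohomology as a colimit of `Abelian.Ext`. -/
lemma exists_locCohDesc {N : Type} [AddCommGroup N] [Module R N]
    (f : ∀ n, Abelian.Ext (powQuot a n) (ModuleCat.of R M) i →ₗ[R] N)
    (hf : ∀ {n m} (h : n ≤ m) (e : Abelian.Ext (powQuot a n) (ModuleCat.of R M) i),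
      f m ((Abelian.Ext.mk₀ (powQuotMap a h)).comp e (zero_add i)) = f n e) :
    ∃ g : locCoh R a i M →ₗ[R] N, ∀ n e, g (locCohι a i M n e) = f n e := by
  let c : Cocone (locCohDiagram a i M) :=
    { pt := ModuleCat.of R N
      ι :=
        { app k := ModuleCat.ofHom (f k.unop.unop ∘ₗ
            (powQuotExtEquiv a i M k.unop.unop).toLinearMap)
          naturality k l φ := by
            ext x
            have h : k.unop.unop ≤ l.unop.unop := leOfHom φ.unop.unop
            exact (congr_arg (f l.unop.unop) (powQuotExtEquiv_map a i M h x)).trans (hf h _) } }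
  refine ⟨((locCohIsColimit a i M).desc c).hom, fun n e ↦ ?_⟩
  obtain ⟨x, rfl⟩ := (powQuotExtEquiv a i M n).surjective e
  rw [locCohι_powQuotExtEquiv]
  exact congr_arg (fun g ↦ g.hom x) ((locCohIsColimit a i M).fac c (op (op n)))

lemma powQuotMap_powQuotMap {n m l : ℕ} (h : n ≤ m) (h' : m ≤ l) :
    powQuotMap a h' ≫ powQuotMap a h = powQuotMap a (h.trans h') := by
  apply ModuleCat.hom_ext
  apply LinearMap.ext
  intro x
  obtain ⟨x, rfl⟩ := Submodule.Quotient.mk_surjective _ x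
  rfl

/-- Composition with an `Ext`-class which is bijective in the colimit induces an isomorphism
on local cohomology. -/
lemma nonempty_locCoh_equiv {N : Type} [AddCommGroup N] [Module R N] {d j : ℕ}
    (y : Abelian.Ext (ModuleCat.of R M) (ModuleCat.of R N) d) (hij : i + d = j)
    (hinj : ∀ (n : ℕ) (e : Abelian.Ext (powQuot a n) (ModuleCat.of R M) i), e.comp y hij = 0 →
      ∃ (m : ℕ) (h : n ≤ m), (Abelian.Ext.mk₀ (powQuotMap a h)).comp e (zero_add i) = 0)
    (hsurj : ∀ (n : ℕ) (e : Abelian.Ext (powQuot a n) (ModuleCat.of R N) j),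
      ∃ (m : ℕ) (h : n ≤ m) (e' : Abelian.Ext (powQuot a m) (ModuleCat.of R M) i),
        e'.comp y hij = (Abelian.Ext.mk₀ (powQuotMap a h)).comp e (zero_add j)) :
    Nonempty (locCoh R a i M ≃ₗ[R] locCoh R a j N) := by
  have hassoc : ∀ {n m} (h : n ≤ m) (e : Abelian.Ext (powQuot a n) (ModuleCat.of R M) i),
      ((Abelian.Ext.mk₀ (powQuotMap a h)).comp e (zero_add i)).comp y hij =
      (Abelian.Ext.mk₀ (powQuotMap a h)).comp (e.comp y hij) (zero_add j) := fun h e ↦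
    Abelian.Ext.comp_assoc _ _ _ _ _ (by omega)
  obtain ⟨g, hg⟩ := exists_locCohDesc (a := a) (i := i) (M := M)
    (fun n ↦ locCohι a j N n ∘ₗ y.postcompOfLinear R (powQuot a n) hij)
    (fun h e ↦ (congr_arg _ (hassoc h e)).trans (locCohι_comp h _))
  replace hg : ∀ n e, g (locCohι a i M n e) = locCohι a j N n (e.comp y hij) := hg
  refine ⟨LinearEquiv.ofBijective g ⟨?_, ?_⟩⟩
  · rw [injective_iff_map_eq_zero]
    intro x hx
    obtain ⟨n, e, rfl⟩ := exists_locCohι_eq x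
    rw [hg] at hx
    obtain ⟨m, h, hm⟩ := exists_comp_eq_zero_of_locCohι_eq_zero _ hx
    rw [← hassoc] at hm
    obtain ⟨l, h', hl⟩ := hinj _ _ hm
    rw [← locCohι_comp h, ← locCohι_comp h', hl, map_zero]
  · intro x
    obtain ⟨n, e, rfl⟩ := exists_locCohι_eq x
    obtain ⟨m, h, e', he'⟩ := hsurj n e
    exact ⟨locCohι a i M m e', by rw [hg, he', locCohι_comp]⟩

/-- The homomorphism from `R / a ^ n` determined by an element killed by `a ^ n`. -/
def powQuotHom {n : ℕ} (x : M) (hx : ∀ r ∈ a ^ n, r • x = 0) :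
    powQuot a n ⟶ ModuleCat.of R M :=
  ModuleCat.ofHom (Submodule.liftQ _ (LinearMap.toSpanSingleton R M x) hx)

lemma powQuotHom_one {n : ℕ} (x : M) (hx : ∀ r ∈ a ^ n, r • x = 0) :
    (powQuotHom x hx).hom (1 : R ⧸ a ^ n) = x :=
  one_smul R x

lemma powQuot_hom_ext {n : ℕ} {Y : ModuleCat.{0} R} {f g : powQuot a n ⟶ Y}
    (h : f.hom (1 : R ⧸ a ^ n) = g.hom (1 : R ⧸ a ^ n)) : f = g := by
  apply ModuleCat.hom_ext
  apply LinearMap.ext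
  intro x
  obtain ⟨x, rfl⟩ := Submodule.Quotient.mk_surjective _ x
  have hx : (Submodule.Quotient.mk x : R ⧸ a ^ n) = x • (1 : R ⧸ a ^ n) := by
    rw [Algebra.smul_def, mul_one]
    rfl
  rw [hx, map_smul, map_smul, h]

lemma smul_powQuot_one {n : ℕ} {r : R} (hr : r ∈ a ^ n) : r • (1 : R ⧸ a ^ n) = 0 := by
  rw [Algebra.smul_def, mul_one]
  exact Ideal.Quotient.eq_zero_iff_mem.mpr hr

lemma powQuot_hom_one_mem {n : ℕ} (f : powQuot a n ⟶ ModuleCat.of R M) (r : R) (hr : r ∈ a ^ n) :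
    r • (f.hom (1 : R ⧸ a ^ n) : M) = 0 :=
  (map_smul f.hom r (1 : R ⧸ a ^ n)).symm.trans
    ((congr_arg f.hom (smul_powQuot_one hr)).trans (map_zero _))

variable (a M) in
/-- Evaluation at `1` of the homomorphism corresponding to an element of `Ext (R / a ^ n) M 0`. -/
def extZeroEval (n : ℕ) : Abelian.Ext (powQuot a n) (ModuleCat.of R M) 0 →ₗ[R] M :=
  LinearMap.applyₗ (1 : R ⧸ a ^ n) ∘ₗ
    (Abelian.Ext.linearEquiv₀ (R := R).trans ModuleCat.homLinearEquiv).toLinearMap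

lemma extZeroEval_mk₀ {n : ℕ} (f : powQuot a n ⟶ ModuleCat.of R M) :
    extZeroEval a M n (Abelian.Ext.mk₀ f) = f.hom (1 : R ⧸ a ^ n) :=
  congr_arg (fun f : powQuot a n ⟶ ModuleCat.of R M ↦ f.hom (1 : R ⧸ a ^ n))
    (Abelian.Ext.linearEquiv₀ (R := R).apply_symm_apply f)

variable (a M) in
/-- The zeroth local cohomology is the torsion submodule. -/
lemma nonempty_locCoh_zero_equiv : Nonempty (locCoh R a 0 M ≃ₗ[R] powTorsion a M) := by
  obtain ⟨g, hg⟩ := exists_locCohDesc (extZeroEval a M)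
    (fun {n m} h e ↦ by
      obtain ⟨f, rfl⟩ := Abelian.Ext.linearEquiv₀ (R := R).symm.surjective e
      simp only [Abelian.Ext.linearEquiv₀_symm_apply]
      erw [Abelian.Ext.mk₀_comp_mk₀]
      rw [extZeroEval_mk₀, extZeroEval_mk₀]
      rfl)
  have hg' : ∀ n (f : powQuot a n ⟶ ModuleCat.of R M),
      g (locCohι a 0 M n (Abelian.Ext.mk₀ f)) = f.hom (1 : R ⧸ a ^ n) :=
    fun n f ↦ (hg n _).trans (extZeroEval_mk₀ f)
  have hrange : LinearMap.range g = powTorsion a M := by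
    ext x
    constructor
    · rintro ⟨y, rfl⟩
      obtain ⟨n, e, rfl⟩ := exists_locCohι_eq y
      obtain ⟨f, rfl⟩ := Abelian.Ext.linearEquiv₀ (R := R).symm.surjective e
      refine ⟨n, fun r hr ↦ ?_⟩
      erw [hg']
      exact powQuot_hom_one_mem f r hr
    · rintro ⟨n, hn⟩
      exact ⟨locCohι a 0 M n (Abelian.Ext.mk₀ (powQuotHom x hn)),
        (hg' _ _).trans (powQuotHom_one x hn)⟩
  have hinj : Function.Injective g := by
    rw [injective_iff_map_eq_zero]
    intro y hy
    obtain ⟨n, e, rfl⟩ := exists_locCohι_eq y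
    obtain ⟨f, rfl⟩ := Abelian.Ext.linearEquiv₀ (R := R).symm.surjective e
    erw [hg'] at hy
    have : f = 0 := powQuot_hom_ext hy
    rw [this, map_zero, map_zero]
  exact ⟨(LinearEquiv.ofInjective g hinj).trans (LinearEquiv.ofEq _ _ hrange)⟩

end LocCohDesc

section LocCohSequences

variable {R : Type} [CommRing R] {a : Ideal R} {M : Type} [AddCommGroup M] [Module R M]

lemma powTorsion_eq_top_of_surjective {N : Type} [AddCommGroup N] [Module R N]
    (h : powTorsion a M = ⊤) (f : M →ₗ[R] N) (hf : Function.Surjective f) :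
    powTorsion a N = ⊤ := by
  rw [eq_top_iff]
  rintro y -
  obtain ⟨x, rfl⟩ := hf y
  obtain ⟨n, hn⟩ := (h.ge Submodule.mem_top : x ∈ powTorsion a M)
  exact ⟨n, fun r hr ↦ by rw [← map_smul, hn r hr, map_zero]⟩

lemma powTorsion_powTorsion : powTorsion a (powTorsion a M) = ⊤ := by
  rw [eq_top_iff]
  rintro ⟨y, n, hn⟩ -
  exact ⟨n, fun r hr ↦ Subtype.ext (hn r hr)⟩

lemma exists_mk₀_eq {X Y : ModuleCat.{0} R} (e : Abelian.Ext X Y 0) :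
    ∃ f : X ⟶ Y, Abelian.Ext.mk₀ f = e :=
  Abelian.Ext.linearEquiv₀ (R := R).symm.surjective e

/-- Positive degree `Ext`-classes with values in an `a`-torsion module vanish in the colimit. -/
lemma exists_mk₀_powQuotMap_comp_eq_zero [IsNoetherianRing R] (h : powTorsion a M = ⊤) {n j : ℕ}
    (e : Abelian.Ext (powQuot a n) (ModuleCat.of R M) (j + 1)) :
    ∃ (m : ℕ) (h : n ≤ m),
      (Abelian.Ext.mk₀ (powQuotMap a h)).comp e (zero_add (j + 1)) = 0 := by
  induction j generalizing M with
  | zero =>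
    obtain ⟨E, _, _, _, f, hf, hE⟩ := exists_injective_powTorsion_eq_top a h
    have hS := shortExact_cokerShortComplex hf
    have : CategoryTheory.Injective (ModuleCat.of R E) :=
      Module.injective_object_of_injective_module R E
    obtain ⟨c, hc⟩ := Abelian.Ext.covariant_sequence_exact₁ (powQuot a n) hS e
      (Abelian.Ext.eq_zero_of_injective _) (zero_add 1)
    obtain ⟨φ, rfl⟩ := exists_mk₀_eq c
    obtain ⟨y, hy⟩ := Submodule.mkQ_surjective _ (φ.hom (1 : R ⧸ a ^ n))
    obtain ⟨k, hk⟩ := (hE.ge Submodule.mem_top : y ∈ powTorsion a E)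
    have hk' : ∀ r ∈ a ^ max n k, r • y = 0 := fun r hr ↦
      hk r (Ideal.pow_le_pow_right (le_max_right _ _) hr)
    have hφ : powQuotMap a (le_max_left n k) ≫ φ =
        powQuotHom y hk' ≫ (cokerShortComplex f).g := by
      apply powQuot_hom_ext
      refine Eq.trans ?_ (hy.symm.trans (congr_arg _ (powQuotHom_one y hk').symm))
      rfl
    refine ⟨max n k, le_max_left _ _, ?_⟩
    subst hc
    rw [Abelian.Ext.mk₀_comp_mk₀_assoc, hφ, ← Abelian.Ext.mk₀_comp_mk₀_assoc, hS.comp_extClass,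
      Abelian.Ext.comp_zero]
  | succ j ih =>
    obtain ⟨E, _, _, _, f, hf, hE⟩ := exists_injective_powTorsion_eq_top a h
    have hS := shortExact_cokerShortComplex hf
    have : CategoryTheory.Injective (ModuleCat.of R E) :=
      Module.injective_object_of_injective_module R E
    obtain ⟨c, hc⟩ := Abelian.Ext.covariant_sequence_exact₁ (powQuot a n) hS e
      (Abelian.Ext.eq_zero_of_injective _) rfl
    obtain ⟨m, hm, h0⟩ := ih
      (powTorsion_eq_top_of_surjective hE _ (Submodule.mkQ_surjective (LinearMap.range f))) c
    refine ⟨m, hm, ?_⟩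
    subst hc
    rw [← Abelian.Ext.comp_assoc _ _ _ (zero_add (j + 1)) rfl (by omega), h0,
      Abelian.Ext.zero_comp]

/-- Dividing by the torsion does not change local cohomology in positive degrees. -/
lemma nonempty_locCoh_quotient_powTorsion_equiv [IsNoetherianRing R] (j : ℕ) :
    Nonempty (locCoh R a (j + 1) M ≃ₗ[R]
      locCoh R a (j + 1) (M ⧸ LinearMap.range (powTorsion a M).subtype)) := by
  have hS := shortExact_cokerShortComplex (powTorsion a M).injective_subtype
  refine nonempty_locCoh_equiv
    (Abelian.Ext.mk₀ (cokerShortComplex (powTorsion a M).subtype).g) (add_zero _)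
    (fun n e he ↦ ?_) fun n e ↦ ?_
  · obtain ⟨c, hc⟩ := Abelian.Ext.covariant_sequence_exact₂ (powQuot a n) hS e he
    obtain ⟨m, hm, h0⟩ := exists_mk₀_powQuotMap_comp_eq_zero powTorsion_powTorsion c
    refine ⟨m, hm, ?_⟩
    subst hc
    rw [← Abelian.Ext.comp_assoc _ _ _ (zero_add (j + 1)) _ (by omega), h0,
      Abelian.Ext.zero_comp]
  · obtain ⟨m, hm, h0⟩ := exists_mk₀_powQuotMap_comp_eq_zero powTorsion_powTorsion
      (e.comp hS.extClass rfl)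
    rw [← Abelian.Ext.comp_assoc _ _ _ (zero_add (j + 1)) _ (by omega)] at h0
    obtain ⟨c, hc⟩ := Abelian.Ext.covariant_sequence_exact₃ (powQuot a m) hS _ rfl h0
    exact ⟨m, hm, c, hc⟩

lemma ext_powQuot_eq_zero {E : Type} [AddCommGroup E] [Module R E] [Module.Injective R E]
    (hE : powTorsion a E = ⊥) {n j : ℕ} (e : Abelian.Ext (powQuot a n) (ModuleCat.of R E) j) :
    e = 0 := by
  cases j with
  | zero =>
    obtain ⟨f, rfl⟩ := exists_mk₀_eq e
    have hf : f.hom (1 : R ⧸ a ^ n) ∈ powTorsion a E := ⟨n, powQuot_hom_one_mem f⟩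
    rw [hE, Submodule.mem_bot] at hf
    have : f = 0 := powQuot_hom_ext hf
    rw [this, Abelian.Ext.mk₀_zero]
  | succ j =>
    have : CategoryTheory.Injective (ModuleCat.of R E) :=
      Module.injective_object_of_injective_module R E
    exact Abelian.Ext.eq_zero_of_injective e

section Shift

variable {E : Type} [AddCommGroup E] [Module R E] [Module.Injective R E] {f : M →ₗ[R] E}

lemma eq_zero_of_comp_extClass_eq_zero (hE : powTorsion a E = ⊥) (hf : Function.Injective f)
    {n j : ℕ} (e : Abelian.Ext (powQuot a n) (ModuleCat.of R (E ⧸ LinearMap.range f)) j)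
    (he : e.comp (shortExact_cokerShortComplex hf).extClass rfl = 0) : e = 0 := by
  obtain ⟨c, rfl⟩ := Abelian.Ext.covariant_sequence_exact₃ (powQuot a n)
    (shortExact_cokerShortComplex hf) e rfl he
  rw [ext_powQuot_eq_zero hE c, Abelian.Ext.zero_comp]

lemma exists_comp_extClass_eq (hE : powTorsion a E = ⊥) (hf : Function.Injective f)
    {n j : ℕ} (e : Abelian.Ext (powQuot a n) (ModuleCat.of R M) (j + 1)) :
    ∃ c : Abelian.Ext (powQuot a n) (ModuleCat.of R (E ⧸ LinearMap.range f)) j,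
      c.comp (shortExact_cokerShortComplex hf).extClass rfl = e :=
  Abelian.Ext.covariant_sequence_exact₁ (powQuot a n) (shortExact_cokerShortComplex hf) e
    (ext_powQuot_eq_zero hE _) rfl

/-- Dimension shifting for `Ext`. -/
def extShiftEquiv (hE : powTorsion a E = ⊥) (hf : Function.Injective f) (n j : ℕ) :
    Abelian.Ext (powQuot a n) (ModuleCat.of R (E ⧸ LinearMap.range f)) j ≃ₗ[R]
      Abelian.Ext (powQuot a n) (ModuleCat.of R M) (j + 1) :=
  LinearEquiv.ofBijective
    ((shortExact_cokerShortComplex hf).extClass.postcompOfLinear R (powQuot a n) rfl)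
    ⟨(injective_iff_map_eq_zero _).mpr (eq_zero_of_comp_extClass_eq_zero hE hf),
      exists_comp_extClass_eq hE hf⟩

/-- Dimension shifting for local cohomology. -/
lemma nonempty_locCoh_shift_equiv (hE : powTorsion a E = ⊥) (hf : Function.Injective f) (j : ℕ) :
    Nonempty (locCoh R a j (E ⧸ LinearMap.range f) ≃ₗ[R] locCoh R a (j + 1) M) := by
  refine nonempty_locCoh_equiv (shortExact_cokerShortComplex hf).extClass rfl
    (fun n e he ↦ ⟨n, le_rfl, ?_⟩) fun n e ↦ ?_
  · rw [eq_zero_of_comp_extClass_eq_zero hE hf e he, Abelian.Ext.comp_zero]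
  · obtain ⟨c, hc⟩ := exists_comp_extClass_eq hE hf
      ((Abelian.Ext.mk₀ (powQuotMap a le_rfl)).comp e (zero_add (j + 1)))
    exact ⟨n, le_rfl, c, hc⟩

end Shift

lemma powTorsion_locCoh (i : ℕ) : powTorsion a (locCoh R a i M) = ⊤ := by
  rw [eq_top_iff]
  rintro x -
  obtain ⟨n, e, rfl⟩ := exists_locCohι_eq x
  refine ⟨n, fun r hr ↦ ?_⟩
  have h0 : r • 𝟙 (powQuot a n) = 0 := powQuot_hom_ext (smul_powQuot_one hr)
  have : r • e = 0 := by
    conv_lhs => rw [← Abelian.Ext.mk₀_id_comp e, ← Abelian.Ext.smul_comp, ← Abelian.Ext.mk₀_smul,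
      h0, Abelian.Ext.mk₀_zero, Abelian.Ext.zero_comp]
  rw [← map_smul, this, map_zero]

end LocCohSequences

section SkinnyLocCoh

variable {R : Type} [CommRing R]

lemma IsSkinny.ext_zero_of_injective {X Y : Type} [AddCommGroup X] [Module R X] [AddCommGroup Y]
    [Module R Y] {N : ModuleCat.{0} R} (h : IsSkinny R (Abelian.Ext N (ModuleCat.of R Y) 0))
    (f : X →ₗ[R] Y) (hf : Function.Injective f) :
    IsSkinny R (Abelian.Ext N (ModuleCat.of R X) 0) :=
  h.of_injective ((Abelian.Ext.mk₀ (ModuleCat.ofHom f)).postcompOfLinear R N (add_zero 0))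
    (injective_ext_zero_comp_mk₀ N _ hf)

variable [IsNoetherianRing R] {a : Ideal R}

lemma IsSkinny.ext_quotient {X : Type} [AddCommGroup X] [Module R X] (P : Submodule R X)
    {N : ModuleCat.{0} R} [Module.Finite R N] {j : ℕ}
    (h : IsSkinny R (Abelian.Ext N (ModuleCat.of R X) j)) (hP : IsSkinny R P) :
    IsSkinny R (Abelian.Ext N (ModuleCat.of R (X ⧸ LinearMap.range P.subtype)) j) := by
  have hS := shortExact_cokerShortComplex P.injective_subtype
  refine IsSkinny.of_exact h (IsSkinny.ext N (ModuleCat.of R P) hP (j + 1))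
    ((Abelian.Ext.mk₀ (cokerShortComplex P.subtype).g).postcompOfLinear R N (add_zero j))
    (hS.extClass.postcompOfLinear R N rfl) fun e ↦ ⟨fun he ↦ ?_, ?_⟩
  · obtain ⟨c, hc⟩ := Abelian.Ext.covariant_sequence_exact₃ N hS e rfl he
    exact ⟨c, hc⟩
  · rintro ⟨c, rfl⟩
    change (c.comp (Abelian.Ext.mk₀ (cokerShortComplex P.subtype).g) (add_zero j)).comp
      hS.extClass rfl = 0
    rw [Abelian.Ext.comp_assoc _ _ _ (add_zero j) (zero_add 1) (by omega), hS.comp_extClass,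
      Abelian.Ext.comp_zero]

/-- If `Ext (R / a) M j` is skinny for `j ≤ t` and the local cohomology modules of `M` are skinny
below `t`, then `Hom (R / a) (H ^ t)` is skinny. -/
theorem IsSkinny.ext_zero_locCoh (t : ℕ) (M : Type) [AddCommGroup M] [Module R M]
    (hext : ∀ j ≤ t, IsSkinny R (Abelian.Ext (powQuot a 1) (ModuleCat.of R M) j))
    (hloc : ∀ j < t, IsSkinny R (locCoh R a j M)) :
    IsSkinny R (Abelian.Ext (powQuot a 1) (ModuleCat.of R (locCoh R a t M)) 0) := by
  obtain ⟨e⟩ := nonempty_locCoh_zero_equiv a M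
  induction t generalizing M with
  | zero =>
    exact (hext 0 le_rfl).ext_zero_of_injective ((powTorsion a M).subtype ∘ₗ e.toLinearMap)
      ((powTorsion a M).injective_subtype.comp e.injective)
  | succ t ih =>
    have hΓ : IsSkinny R (powTorsion a M) :=
      (hloc 0 t.succ_pos).of_injective e.symm.toLinearMap e.symm.injective
    obtain ⟨E, _, _, _, f, hf, hE⟩ := exists_injective_powTorsion_eq_bot (a := a)
      (X := M ⧸ LinearMap.range (powTorsion a M).subtype)
      (by rw [Submodule.range_subtype]; exact powTorsion_quotient_eq_bot a M)
    have equiv (j : ℕ) : Nonempty (locCoh R a (j + 1) M ≃ₗ[R]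
        locCoh R a j (E ⧸ LinearMap.range f)) := by
      obtain ⟨e₁⟩ := nonempty_locCoh_quotient_powTorsion_equiv (a := a) (M := M) j
      obtain ⟨e₂⟩ := nonempty_locCoh_shift_equiv hE hf j
      exact ⟨e₁.trans e₂.symm⟩
    obtain ⟨e₀⟩ := nonempty_locCoh_zero_equiv a (E ⧸ LinearMap.range f)
    obtain ⟨e₁⟩ := equiv t
    refine (ih (E ⧸ LinearMap.range f) (fun j hj ↦ ?_) (fun j hj ↦ ?_) e₀).ext_zero_of_injective
      e₁.toLinearMap e₁.injective
    · exact ((hext (j + 1) (by omega)).ext_quotient _ hΓ).of_injective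
        (extShiftEquiv hE hf 1 j).toLinearMap (LinearEquiv.injective _)
    · obtain ⟨e₂⟩ := equiv j
      exact (hloc (j + 1) (by omega)).of_injective e₂.symm.toLinearMap e₂.symm.injective

/-- The associated primes of an `a`-torsion module `X` are associated to `Hom (R / a) X`. -/
lemma associatedPrimes_subset_ext_zero {X : Type} [AddCommGroup X] [Module R X]
    (hX : powTorsion a X = ⊤) :
    associatedPrimes R X ⊆ associatedPrimes R (Abelian.Ext (powQuot a 1) (ModuleCat.of R X) 0) := by
  intro p hp
  rw [AssociatedPrimes.mem_iff, isAssociatedPrime_iff] at hp ⊢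
  obtain ⟨hp, y, hy⟩ := hp
  have hmem (r : R) : r ∈ p ↔ r • y = 0 := by
    rw [hy, Submodule.mem_colon_singleton, Submodule.mem_bot]
  obtain ⟨n, hn⟩ := (hX.ge Submodule.mem_top : y ∈ powTorsion a X)
  have hap : a ≤ p := Ideal.IsPrime.le_of_pow_le (n := n) fun r hr ↦ (hmem r).mpr (hn r hr)
  have hy₁ : ∀ r ∈ a ^ 1, r • y = 0 := fun r hr ↦ (hmem r).mp (hap (by simpa using hr))
  refine ⟨hp, Abelian.Ext.mk₀ (powQuotHom y hy₁), ?_⟩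
  ext r
  rw [hmem, Submodule.mem_colon_singleton, Submodule.mem_bot]
  constructor
  · intro h
    have : r • powQuotHom y hy₁ = 0 :=
      powQuot_hom_ext ((congr_arg (r • ·) (powQuotHom_one y hy₁)).trans h)
    rw [← Abelian.Ext.mk₀_smul, this, Abelian.Ext.mk₀_zero]
  · intro h
    have := congr_arg (extZeroEval a X 1) h
    rwa [map_smul, map_zero, extZeroEval_mk₀, powQuotHom_one] at this

/-- Over a semilocal ring, an `a`-torsion module `X` in dimension `< 2` is skinny as soon as
`Hom (R / a) X` is. -/
lemma InDimLT.isSkinny (hs : {I : Ideal R | I.IsMaximal}.Finite) {X : Type} [AddCommGroup X]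
    [Module R X] (hX : powTorsion a X = ⊤)
    (hext : IsSkinny R (Abelian.Ext (powQuot a 1) (ModuleCat.of R X) 0)) (h : InDimLT R X 2) :
    IsSkinny R X := by
  obtain ⟨N, hN, hdim⟩ := h
  have : Module.Finite R N := Module.Finite.iff_fg.mpr hN
  have hquot := hext.ext_quotient N IsSkinny.of_finite
  rw [Submodule.range_subtype] at hquot
  have hass : (associatedPrimes R (X ⧸ N)).Finite := by
    refine (hquot ⊥).subset ((associatedPrimes_subset_ext_zero
      (powTorsion_eq_top_of_surjective hX N.mkQ N.mkQ_surjective)).trans ?_)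
    exact associatedPrimes.subset_of_injective
      (f := (Submodule.quotEquivOfEqBot ⊥ rfl).symm.toLinearMap) (LinearEquiv.injective _)
  exact IsSkinny.of_exact (IsSkinny.of_finite (A := N))
    (IsSkinny.of_support_finite (Module.support_finite_of_semilocal hs hass hdim))
    N.subtype N.mkQ (LinearMap.exact_subtype_mkQ N)

end SkinnyLocCoh

/-- Over a semilocal Noetherian ring, `h_a^2(M)` is the least `i` such that `H^i_a(M)` is
not skinny. -/
theorem hDimN_two_eq_inf_not_skinny (R : Type) [CommRing R] [IsNoetherianRing R]
    (hsemilocal : {I : Ideal R | I.IsMaximal}.Finite) (a : Ideal R)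
    (M : Type) [AddCommGroup M] [Module R M] [Module.Finite R M] :
    hDimN R a 2 M = sInf (Nat.cast '' {i : ℕ | ¬ IsSkinny R ↥(locCoh R a i M)}) := by
  refine le_antisymm (le_sInf ?_) (sInf_le_sInf (Set.image_mono fun i hi h ↦ hi h.inDimLT_two))
  rintro _ ⟨i, hi, rfl⟩
  classical
  have hex : ∃ i, ¬ IsSkinny R (locCoh R a i M) := ⟨i, hi⟩
  refine le_trans (sInf_le ⟨Nat.find hex, fun hdim ↦ ?_, rfl⟩)
    (Nat.cast_le.mpr (Nat.find_min' hex hi))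
  have hext (j : ℕ) : IsSkinny R (Abelian.Ext (powQuot a 1) (ModuleCat.of R M) j) :=
    have := ModuleCat.finite_ext R (powQuot a 1) (ModuleCat.of R M) j
    IsSkinny.of_finite
  exact Nat.find_spec hex (hdim.isSkinny hsemilocal (powTorsion_locCoh _)
    (IsSkinny.ext_zero_locCoh _ M (fun j _ ↦ hext j)
      fun j hj ↦ not_not.mp (Nat.find_min hex hj)))
end
end

section
/- Let R be a commutative Noetherian ring and n a non-negative integer. Given a short exact sequence 0 → M' → M → M'' → 0 of R-modules, the module M is in dimension < n if and only if both M' and M'' are in dimension < n. -/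
/-- The Krull dimension of a union of two upper sets is at most the larger of the two
Krull dimensions. -/
lemma Order.krullDim_union_le_of_isUpperSet {α : Type*} [Preorder α] {s t : Set α}
    (hs : IsUpperSet s) (ht : IsUpperSet t) :
    Order.krullDim ↥(s ∪ t) ≤ max (Order.krullDim s) (Order.krullDim t) := by
  refine iSup_le fun c ↦ ?_
  have head_le (i : Fin (c.length + 1)) : (c.head : α) ≤ c i :=
    c.monotone (Fin.zero_le i)
  rcases c.head.2 with h | h
  · exact le_max_of_le_left <| LTSeries.length_le_krullDim
      ⟨c.length, fun i ↦ ⟨c i, hs (head_le i) h⟩, fun i ↦ c.step i⟩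
  · exact le_max_of_le_right <| LTSeries.length_le_krullDim
      ⟨c.length, fun i ↦ ⟨c i, ht (head_le i) h⟩, fun i ↦ c.step i⟩

/-- The support of a module is stable under specialization. -/
lemma Module.isUpperSet_support (R M : Type*) [CommRing R] [AddCommGroup M] [Module R M] :
    IsUpperSet (Module.support R M) :=
  fun _ _ h hp ↦ Module.mem_support_mono h hp

/-- The dimension of the support of the middle term of a short exact sequence is at most the
maximum of those of the outer terms. -/
lemma Module.supportDim_le_max_of_exact {R M N P : Type*} [CommRing R] [AddCommGroup M]
    [Module R M] [AddCommGroup N] [Module R N] [AddCommGroup P] [Module R P]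
    {f : M →ₗ[R] N} {g : N →ₗ[R] P} (h : Function.Exact f g) (hf : Function.Injective f)
    (hg : Function.Surjective g) :
    Module.supportDim R N ≤ max (Module.supportDim R M) (Module.supportDim R P) := by
  rw [Module.supportDim, Module.support_of_exact h hf hg]
  exact Order.krullDim_union_le_of_isUpperSet (Module.isUpperSet_support R M)
    (Module.isUpperSet_support R P)

section mapQ

variable {R M M' M'' : Type*} [CommRing R] [AddCommGroup M] [Module R M] [AddCommGroup M']
  [Module R M'] [AddCommGroup M''] [Module R M'']

lemma Submodule.mapQ_comap_injective (f : M' →ₗ[R] M) (N : Submodule R M) :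
    Function.Injective ((N.comap f).mapQ N f le_rfl) := by
  rw [← LinearMap.ker_eq_bot, Submodule.ker_mapQ, Submodule.mkQ_map_self]

lemma Submodule.mapQ_surjective (p : Submodule R M) (q : Submodule R M'') {g : M →ₗ[R] M''}
    (h : p ≤ q.comap g) (hg : Function.Surjective g) :
    Function.Surjective (p.mapQ q g h) := by
  intro x
  obtain ⟨y, rfl⟩ := q.mkQ_surjective x
  obtain ⟨z, rfl⟩ := hg y
  exact ⟨p.mkQ z, rfl⟩

lemma Submodule.exact_mapQ_comap_mapQ_map {f : M' →ₗ[R] M} {g : M →ₗ[R] M''}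
    (hfg : Function.Exact f g) (N : Submodule R M) :
    Function.Exact ((N.comap f).mapQ N f le_rfl)
      (N.mapQ (N.map g) g (Submodule.le_comap_map g N)) := by
  intro x
  obtain ⟨y, rfl⟩ := N.mkQ_surjective x
  constructor
  · intro h
    obtain ⟨z, hz, hzy⟩ := (Submodule.Quotient.mk_eq_zero (N.map g)).mp h
    obtain ⟨w, hw⟩ := (hfg (y - z)).mp (by rw [map_sub, hzy, sub_self])
    refine ⟨(N.comap f).mkQ w, (Submodule.Quotient.eq N).mpr ?_⟩
    rw [hw, sub_sub_cancel_left]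
    exact N.neg_mem hz
  · rintro ⟨w, hw⟩
    obtain ⟨w, rfl⟩ := (N.comap f).mkQ_surjective w
    rw [← hw]
    exact (congrArg (N.map g).mkQ (hfg.apply_apply_eq_zero w)).trans (map_zero _)

end mapQ


open CategoryTheory

noncomputable section

/-- Given a short exact sequence `0 → M' → M → M'' → 0` of `R`-modules over a Noetherian ring,
`M` is in dimension `< n` iff both `M'` and `M''` are in dimension `< n`. -/
theorem inDimLT_iff_of_shortExact (R : Type) [CommRing R] [IsNoetherianRing R] (n : ℕ)
    (M' M M'' : Type) [AddCommGroup M'] [Module R M'] [AddCommGroup M] [Module R M]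
    [AddCommGroup M''] [Module R M'']
    (f : M' →ₗ[R] M) (g : M →ₗ[R] M'')
    (hf : Function.Injective f) (hg : Function.Surjective g) (hfg : Function.Exact f g) :
    InDimLT R M n ↔ InDimLT R M' n ∧ InDimLT R M'' n := by
  constructor
  · rintro ⟨N, hN, hdim⟩
    have : IsNoetherian R N := isNoetherian_of_fg_of_noetherian N hN
    refine ⟨⟨N.comap f, ?_, ?_⟩, N.map g, hN.map g, ?_⟩
    · refine Submodule.fg_of_fg_map_injective f hf ?_
      have hle : (N.comap f).map f ≤ N := Submodule.map_comap_le f N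
      have := isNoetherian_of_le hle
      exact Module.Finite.iff_fg.mp inferInstance
    · exact (Module.supportDim_le_of_injective _
        (Submodule.mapQ_comap_injective f N)).trans_lt hdim
    · exact (Module.supportDim_le_of_surjective _
        (Submodule.mapQ_surjective N _ (Submodule.le_comap_map g N) hg)).trans_lt hdim
  · rintro ⟨⟨N', hN', hdim'⟩, N'', hN'', hdim''⟩
    obtain ⟨K, hK, rfl⟩ : ∃ K : Submodule R M, K.FG ∧ K.map g = N'' := by
      obtain ⟨s, hs, rfl⟩ := Submodule.fg_def.mp hN''
      refine ⟨Submodule.span R (Function.surjInv hg '' s),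
        Submodule.fg_span (hs.image _), ?_⟩
      rw [Submodule.map_span, Set.image_image]
      simp only [Function.surjInv_eq, Set.image_id']
    have hmap : (N'.map f ⊔ K).map g = K.map g := by
      rw [Submodule.map_sup, ← Submodule.map_comp, hfg.linearMap_comp_eq_zero,
        Submodule.map_zero, bot_sup_eq]
    refine ⟨N'.map f ⊔ K, (hN'.map f).sup hK, ?_⟩
    refine (Module.supportDim_le_max_of_exact
      (Submodule.exact_mapQ_comap_mapQ_map hfg (N'.map f ⊔ K))
      (Submodule.mapQ_comap_injective f _)
      (Submodule.mapQ_surjective _ _ (Submodule.le_comap_map g _) hg)).trans_lt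
      (max_lt ?_ (by rwa [hmap]))
    have hle : N' ≤ (N'.map f ⊔ K).comap f := Submodule.map_le_iff_le_comap.mp le_sup_left
    exact (Module.supportDim_le_of_surjective (Submodule.factor hle)
      (Submodule.factor_surjective hle)).trans_lt hdim'
end
end

section
/- Let R be a commutative Noetherian ring and n a non-negative integer. Let M and N be R-modules with M finitely generated and N in dimension < n. Then Tor_i^R(M, N) is in dimension < n for every i ≥ 0. -/
open CategoryTheory

noncomputable section

section InDimLT

variable {R : Type} [CommRing R] {n : ℕ}

lemma InDimLT.of_injective [IsNoetherianRing R] {A B : Type} [AddCommGroup A] [Module R A]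
    [AddCommGroup B] [Module R B] (f : A →ₗ[R] B) (hf : Function.Injective f)
    (hB : InDimLT R B n) : InDimLT R A n := by
  obtain ⟨N, hN, hdim⟩ := hB
  have : Module.Finite R N := Module.Finite.iff_fg.mpr hN
  refine ⟨N.comap f, ?_, ?_⟩
  · rw [← Module.Finite.iff_fg]
    refine Module.Finite.of_injective (f.restrict (p := N.comap f) (q := N) fun _ hx => hx) ?_
    intro x y hxy
    exact Subtype.ext (hf (congrArg Subtype.val hxy))
  · refine lt_of_le_of_lt (Module.supportDim_le_of_injective
      ((N.comap f).mapQ N f le_rfl) ?_) hdim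
    rw [← LinearMap.ker_eq_bot, Submodule.ker_mapQ]
    exact Submodule.mkQ_map_self _

lemma Module.support_tensorProduct_subset_right {M N : Type} [AddCommGroup M] [Module R M]
    [AddCommGroup N] [Module R N] :
    Module.support R (TensorProduct R M N) ⊆ Module.support R N := by
  intro p
  contrapose
  simp only [Module.notMem_support_iff']
  intro h x
  induction x with
  | zero => exact ⟨1, p.asIdeal.primeCompl.one_mem, smul_zero 1⟩
  | tmul x y =>
    obtain ⟨r, hr, hy⟩ := h y
    exact ⟨r, hr, by rw [← TensorProduct.tmul_smul, hy, TensorProduct.tmul_zero]⟩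
  | add x y hx hy =>
    obtain ⟨r, hr, hx⟩ := hx
    obtain ⟨s, hs, hy⟩ := hy
    exact ⟨r * s, p.asIdeal.primeCompl.mul_mem hr hs, by
      rw [smul_add, mul_comm, mul_smul, hx, mul_comm, mul_smul, hy, smul_zero, smul_zero, add_zero]⟩

lemma InDimLT.tensorProduct (M : Type) {N : Type} [AddCommGroup M] [Module R M]
    [Module.Finite R M] [AddCommGroup N] [Module R N] (hN : InDimLT R N n) :
    InDimLT R (TensorProduct R M N) n := by
  obtain ⟨N', hN', hdim⟩ := hN
  have : Module.Finite R N' := Module.Finite.iff_fg.mpr hN'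
  refine ⟨LinearMap.range (N'.subtype.lTensor M), ?_, ?_⟩
  · rw [← Module.Finite.iff_fg]
    infer_instance
  · have e := lTensor.equiv M (f := N'.subtype) (g := N'.mkQ)
      (LinearMap.exact_subtype_mkQ N') N'.mkQ_surjective
    refine lt_of_le_of_lt ?_ hdim
    refine (Module.supportDim_eq_of_equiv e).le.trans ?_
    exact Order.krullDim_le_of_strictMono
      (fun a => ⟨a.1, Module.support_tensorProduct_subset_right a.2⟩) fun _ _ h => h

end InDimLT

section Tor

open MonoidalCategory

variable {R : Type} [CommRing R]

/-- Tensoring a chain complex on the left with a short complex of modules. -/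
def tensorChainComplex (S : ShortComplex (ModuleCat R)) (K : ChainComplex (ModuleCat R) ℕ) :
    ShortComplex (ChainComplex (ModuleCat R) ℕ) where
  X₁ := (((tensoringLeft _).obj S.X₁).mapHomologicalComplex _).obj K
  X₂ := (((tensoringLeft _).obj S.X₂).mapHomologicalComplex _).obj K
  X₃ := (((tensoringLeft _).obj S.X₃).mapHomologicalComplex _).obj K
  f := (NatTrans.mapHomologicalComplex ((tensoringLeft _).map S.f) _).app K
  g := (NatTrans.mapHomologicalComplex ((tensoringLeft _).map S.g) _).app K
  zero := by
    ext1 i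
    change S.f ▷ K.X i ≫ S.g ▷ K.X i = 0
    rw [← comp_whiskerRight, S.zero, MonoidalPreadditive.zero_whiskerRight]

lemma tensorChainComplex_shortExact {S : ShortComplex (ModuleCat R)} (hS : S.ShortExact)
    (K : ChainComplex (ModuleCat R) ℕ) [∀ i, Module.Flat R (K.X i)] :
    (tensorChainComplex S K).ShortExact :=
  HomologicalComplex.shortExact_of_degreewise_shortExact _ fun i =>
    hS.map_of_exact (tensorRight (K.X i))

lemma isZero_tor_succ_of_flat (F N : ModuleCat R) [Module.Flat R F] (i : ℕ) :
    Limits.IsZero (((Tor (ModuleCat R) (i + 1)).obj F).obj N) := by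
  let P := projectiveResolution N
  refine Limits.IsZero.of_iso ?_ (P.isoLeftDerivedObj ((tensoringLeft _).obj F) (i + 1))
  change Limits.IsZero (HomologicalComplex.homology _ _)
  rw [← HomologicalComplex.exactAt_iff_isZero_homology]
  have h : ((P.complex.sc (i + 1)).map (tensorLeft F)).Exact :=
    Module.Flat.lTensor_shortComplex_exact F _ (P.complex_exactAt_succ i)
  exact h

/-- For a short exact sequence of modules with flat middle term, the connecting map embeds
`Tor (i + 1)` of the right term into `Tor i` of the left term. -/
lemma exists_mono_tor_succ {S : ShortComplex (ModuleCat R)} (hS : S.ShortExact)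
    [Module.Flat R S.X₂] (N : ModuleCat R) (i : ℕ) :
    ∃ f : ((Tor (ModuleCat R) (i + 1)).obj S.X₃).obj N ⟶ ((Tor (ModuleCat R) i).obj S.X₁).obj N,
      Mono f := by
  let P := projectiveResolution N
  have (j : ℕ) : Module.Flat R (P.complex.X j) := by
    have : Module.Projective R (P.complex.X j) :=
      (IsProjective.iff_projective _).mpr (P.projective j)
    infer_instance
  have hT := tensorChainComplex_shortExact hS P.complex
  have hz : Limits.IsZero ((tensorChainComplex S P.complex).X₂.homology (i + 1)) :=
    (isZero_tor_succ_of_flat S.X₂ N i).of_iso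
      (P.isoLeftDerivedObj ((tensoringLeft _).obj S.X₂) (i + 1)).symm
  have := hT.mono_δ (i + 1) i (by simp) hz
  let e₁ : ((Tor (ModuleCat R) i).obj S.X₁).obj N ≅
      (tensorChainComplex S P.complex).X₁.homology i :=
    P.isoLeftDerivedObj ((tensoringLeft _).obj S.X₁) i
  let e₃ : ((Tor (ModuleCat R) (i + 1)).obj S.X₃).obj N ≅
      (tensorChainComplex S P.complex).X₃.homology (i + 1) :=
    P.isoLeftDerivedObj ((tensoringLeft _).obj S.X₃) (i + 1)
  exact ⟨e₃.hom ≫ hT.δ (i + 1) i (by simp) ≫ e₁.inv, inferInstance⟩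

end Tor

/-- If `M` is a finitely generated `R`-module over a Noetherian ring and `N` is in dimension
`< n`, then `Tor_i^R(M, N)` is in dimension `< n` for all `i`. -/
theorem inDimLT_tor (R : Type) [CommRing R] [IsNoetherianRing R] (n : ℕ)
    (M N : Type) [AddCommGroup M] [Module R M] [AddCommGroup N] [Module R N]
    [Module.Finite R M] (hN : InDimLT R N n) (i : ℕ) :
    InDimLT R ↥(((Tor (ModuleCat R) i).obj (ModuleCat.of R M)).obj (ModuleCat.of R N)) n := by
  induction i generalizing M with
  | zero =>
    let e := (((MonoidalCategory.tensoringLeft (ModuleCat R)).obj (ModuleCat.of R M)).leftDerivedZeroIsoSelf.app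
      (ModuleCat.of R N)).toLinearEquiv
    exact InDimLT.of_injective e.toLinearMap e.injective (hN.tensorProduct M)
  | succ i ih =>
    obtain ⟨k, p, hp⟩ := Module.Finite.exists_fin' R M
    let S : ShortComplex (ModuleCat R) :=
      .mk (ModuleCat.ofHom (LinearMap.ker p).subtype) (ModuleCat.ofHom p)
        (by ext x; exact x.2)
    have hS : S.ShortExact :=
      { exact := (ShortComplex.ShortExact.moduleCat_exact_iff_function_exact S).mpr
          p.exact_subtype_ker_map
        mono_f := (ModuleCat.mono_iff_injective _).mpr (LinearMap.ker p).injective_subtype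
        epi_g := (ModuleCat.epi_iff_surjective _).mpr hp }
    have : Module.Flat R S.X₂ := inferInstanceAs (Module.Flat R (Fin k → R))
    obtain ⟨f, hf⟩ := exists_mono_tor_succ hS (ModuleCat.of R N) i
    exact InDimLT.of_injective f.hom ((ModuleCat.mono_iff_injective f).mp hf)
      (ih (LinearMap.ker p))
end
end
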